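/- Let I ⊆ {1,…,n−1} with |I| = k−1, so that I ∪ {n} ⊆ {1,…,n}. Applying the induction operators summand-by-summand to the decompositions R_{n,I} = ⊕_{λ⊢n} ⊕_{S ∈ SYT(λ), Dsi^c(S) ⊆ I} V^S_{h^S_I} and R^hom_{n,I} = ⊕_{λ⊢n} ⊕_{S ∈ SYT(λ), Dsi^c(S) ⊆ I} V^S_{h(I,S)}, one has R_{n+1,I∪{n}} = Ind_{n−k} R_{n,I} and R^hom_{n+1,I∪{n}} = Ind_n R^hom_{n,I} (as subspaces of Q[x_1,…,x_{n+1}]). -/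

import Mathlib

open MvPolynomial

noncomputable section

namespace HigherSpecht

open scoped Classical

/-- A tableau: a filling of the plane (row, column), `0`-indexed, with `0` outside the diagram. -/
abbrev Tab := ℕ × ℕ → ℕ

/-- A permutation of `ℕ` represents an element of `Sₙ` (acting on `{1, …, n}`)
when it fixes `0` and everything above `n`. -/
def SuppIn (n : ℕ) (w : Equiv.Perm ℕ) : Prop := ∀ i, i = 0 ∨ n < i → w i = i

/-- Descending locations of a permutation (one-line notation `w 1, …, w n`). -/
def DslSet (n : ℕ) (w : Equiv.Perm ℕ) : Finset ℕ :=
  (Finset.Ioo 0 n).filter fun i => w (i + 1) < w i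

/-- Ascending locations of a permutation. -/
def AslSet (n : ℕ) (w : Equiv.Perm ℕ) : Finset ℕ :=
  (Finset.Ioo 0 n).filter fun i => w i < w (i + 1)

/-- The row in which the entry `i` shows up in a tableau. -/
def rowIdx (T : Tab) (i : ℕ) : ℕ := sInf {r | ∃ c, T (r, c) = i}

/-- The column in which the entry `i` shows up in a tableau. -/
def colIdx (T : Tab) (i : ℕ) : ℕ := sInf {c | T (rowIdx T i, c) = i}

/-- The box containing the entry `i`. -/
def posOf (T : Tab) (i : ℕ) : ℕ × ℕ := (rowIdx T i, colIdx T i)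

/-- Descending indices of a (standard) tableau: `i` with the row of `i+1` strictly below
the row of `i`. -/
def DsiSet (n : ℕ) (T : Tab) : Finset ℕ :=
  (Finset.Ioo 0 n).filter fun i => rowIdx T i < rowIdx T (i + 1)

/-- `Dsi^c`, the complemented descent set `{n - i | i ∈ Dsi}`. -/
def Dsic (n : ℕ) (T : Tab) : Finset ℕ := (DsiSet n T).image fun i => n - i

/-- The entry of `ct_J(S)` at a box `c`: the number of elements of `J` smaller than the
entry of `S` at `c`. -/
def ctEntry (T : Tab) (J : Finset ℕ) (c : ℕ × ℕ) : ℕ := (J.filter fun j => j < T c).card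

/-- The cocharge tableau `ct(S)` of a standard tableau. -/
def ctTab (n : ℕ) (T : Tab) : Tab := fun c => ctEntry T (DsiSet n T) c

/-- The (total) cocharge `cc(S)`: the sum of the entries of `ct(S)`. -/
def ccStat (n : ℕ) (T : Tab) : ℕ :=
  ∑ i ∈ Finset.Icc 1 n, ctEntry T (DsiSet n T) (posOf T i)

/-- `T` is a bijective filling of the given set of cells by `1, …, n` (`n` the number of
cells), with `0` outside. -/
def IsFillingF (cells : Finset (ℕ × ℕ)) (T : Tab) : Prop :=
  (∀ c, c ∉ cells → T c = 0) ∧ Set.BijOn T ↑cells (Set.Icc 1 cells.card)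

/-- A bijective filling of a Young diagram. -/
def IsFilling (μ : YoungDiagram) (T : Tab) : Prop := IsFillingF μ.cells T

/-- A standard Young tableau of shape `μ`: entries strictly increase along rows and columns. -/
def IsStandard (μ : YoungDiagram) (T : Tab) : Prop :=
  IsFilling μ T ∧ ∀ c₁ ∈ μ.cells, ∀ c₂ ∈ μ.cells,
    c₁ ≠ c₂ → c₁.1 ≤ c₂.1 → c₁.2 ≤ c₂.2 → T c₁ < T c₂

/-! ### Robinson–Schensted -/

/-- Row insertion: insert `x` into a row, returning the new row and the bumped entry. -/
def rowInsert : ℕ → List ℕ → List ℕ × Option ℕ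
  | x, [] => ([x], none)
  | x, y :: ys =>
    if x < y then (x :: ys, some y)
    else
      let p := rowInsert x ys
      (y :: p.1, p.2)

/-- Insertion of an entry into a tableau, given as a list of rows. -/
def tabInsert : List (List ℕ) → ℕ → List (List ℕ)
  | [], x => [[x]]
  | r :: rs, x =>
    match rowInsert x r with
    | (r', none) => r' :: rs
    | (r', some y) => r' :: tabInsert rs y

/-- One-line notation of `w ∈ Sₙ`. -/
def oneLine (n : ℕ) (w : Equiv.Perm ℕ) : List ℕ := (List.range n).map fun i => w (i + 1)

/-- The insertion tableau of the first `m` letters of `w`, as a list of rows. -/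
def PtabListPart (n : ℕ) (w : Equiv.Perm ℕ) (m : ℕ) : List (List ℕ) :=
  ((oneLine n w).take m).foldl tabInsert []

/-- Entry of a list-of-rows tableau at a (0-indexed) cell. -/
def listEntry (t : List (List ℕ)) (c : ℕ × ℕ) : ℕ := (t.getD c.1 []).getD c.2 0

/-- The Robinson–Schensted insertion tableau `P(w)`. -/
def Ptab (n : ℕ) (w : Equiv.Perm ℕ) : Tab := fun c => listEntry (PtabListPart n w n) c

/-- The Robinson–Schensted recording tableau `Q(w)`: the entry of a cell is the step at
which the cell is added to the shape. -/
def Qtab (n : ℕ) (w : Equiv.Perm ℕ) : Tab := fun c =>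
  sInf {m | listEntry (PtabListPart n w m) c ≠ 0}

/-! ### Schützenberger evacuation -/

/-- One step of a jeu de taquin slide into the hole at `c`. -/
def slideOnce (T : Tab) (c : ℕ × ℕ) : Tab × (ℕ × ℕ) :=
  let rc : ℕ × ℕ := (c.1, c.2 + 1)
  let dc : ℕ × ℕ := (c.1 + 1, c.2)
  if T rc = 0 ∧ T dc = 0 then (T, c)
  else if T dc = 0 ∨ (T rc ≠ 0 ∧ T rc < T dc) then
    (Function.update (Function.update T c (T rc)) rc 0, rc)
  else
    (Function.update (Function.update T c (T dc)) dc 0, dc)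

/-- Jeu de taquin slide (with fuel). -/
def slide : ℕ → Tab → ℕ × ℕ → Tab × (ℕ × ℕ)
  | 0, T, c => (T, c)
  | k + 1, T, c =>
    let p := slideOnce T c
    if p.2 = c then (T, c) else slide k p.1 p.2

/-- The Schützenberger evacuation: repeatedly delete the minimal entry, slide into the hole,
decrement the remaining entries, and record the vacated cell. -/
def evacAux : ℕ → Tab → Tab
  | 0, _ => fun _ => 0
  | m + 1, T =>
    let c0 := posOf T 1
    let p := slide (m + 1) (Function.update T c0 0) c0
    Function.update (evacAux m fun c => p.1 c - 1) p.2 (m + 1)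

/-- The evacuation tableau `ev S` of a standard tableau with `n` boxes. -/
def evac (n : ℕ) (T : Tab) : Tab := evacAux n T

/-- `Q̃(w) := ev (Q w)`. -/
def Qt (n : ℕ) (w : Equiv.Perm ℕ) : Tab := evac n (Qtab n w)

/-! ### Row and column groups, higher Specht polynomials -/

/-- The identification of `Fin n` with `{1, …, n} ⊆ ℕ`. -/
def finShift (n : ℕ) : Fin n ≃ {i : ℕ // 1 ≤ i ∧ i ≤ n} where
  toFun j := ⟨(j : ℕ) + 1, by have := j.isLt; omega⟩
  invFun i := ⟨(i : ℕ) - 1, by have := i.2; omega⟩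
  left_inv j := by apply Fin.ext; simp
  right_inv i := by apply Subtype.ext; have := i.2; simp; omega

/-- Embedding of the permutations of `Fin n` into permutations of `ℕ` (acting on `{1, …, n}`). -/
def embedPerm (n : ℕ) (σ : Equiv.Perm (Fin n)) : Equiv.Perm ℕ :=
  σ.extendDomain (finShift n)

/-- The row group `R(T)` of a filling, as a finset of permutations of `Fin n`. -/
def rowFinset (n : ℕ) (T : Tab) : Finset (Equiv.Perm (Fin n)) :=
  Finset.univ.filter fun τ => ∀ i ∈ Finset.Icc 1 n, rowIdx T (embedPerm n τ i) = rowIdx T i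

/-- The column group `C(T)` of a filling, as a finset of permutations of `Fin n`. -/
def colFinset (n : ℕ) (T : Tab) : Finset (Equiv.Perm (Fin n)) :=
  Finset.univ.filter fun σ => ∀ i ∈ Finset.Icc 1 n, colIdx T (embedPerm n σ i) = colIdx T i

/-- The row group `R(T)` as a set of permutations of `ℕ`. -/
def rowGroupSet (n : ℕ) (T : Tab) : Set (Equiv.Perm ℕ) :=
  {w | SuppIn n w ∧ ∀ i ∈ Finset.Icc 1 n, rowIdx T (w i) = rowIdx T i}

/-- The column group `C(T)` as a set of permutations of `ℕ`. -/
def colGroupSet (n : ℕ) (T : Tab) : Set (Equiv.Perm ℕ) :=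
  {w | SuppIn n w ∧ ∀ i ∈ Finset.Icc 1 n, colIdx T (w i) = colIdx T i}

/-- The Young symmetrizer `ε_T = Σ_{σ ∈ C(T)} Σ_{τ ∈ R(T)} sgn(σ) σ τ` acting on polynomials
(permutations acting by permuting the variables). -/
def epsAct (n : ℕ) (T : Tab) (p : MvPolynomial ℕ ℚ) : MvPolynomial ℕ ℚ :=
  ∑ σ ∈ colFinset n T, ∑ τ ∈ rowFinset n T,
    (Equiv.Perm.sign σ : ℤ) • rename (⇑(embedPerm n σ * embedPerm n τ)) p

/-- The monomial `p_T^S = Π_i x_i^{h_i}`, where `h_i` is the entry of `ct S` in the box of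
`T` containing `i`. -/
def pTS (n : ℕ) (T S : Tab) : MvPolynomial ℕ ℚ :=
  ∏ i ∈ Finset.Icc 1 n, X i ^ ctEntry S (DsiSet n S) (posOf T i)

/-- `s_T^S`: the order of the stabilizer of `p_T^S` in `R(T)`. -/
def sTS (n : ℕ) (T S : Tab) : ℕ :=
  ((rowFinset n T).filter fun τ =>
    rename (⇑(embedPerm n τ)) (pTS n T S) = pTS n T S).card

/-- The higher Specht polynomial `F_T^S := ε_T p_T^S / s_T^S`. -/
def FTS (n : ℕ) (T S : Tab) : MvPolynomial ℕ ℚ :=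
  ((sTS n T S : ℚ)⁻¹) • epsAct n T (pTS n T S)

/-- The higher Specht polynomial `F_w := F_{P(w)}^{Q̃(w)}` of a permutation. -/
def Fw (n : ℕ) (w : Equiv.Perm ℕ) : MvPolynomial ℕ ℚ := FTS n (Ptab n w) (Qt n w)

/-- The elementary symmetric polynomial `e_r` in the variables `x_1, …, x_n`. -/
def esym (n r : ℕ) : MvPolynomial ℕ ℚ :=
  ∑ s ∈ (Finset.Icc 1 n).powersetCard r, ∏ i ∈ s, X i

/-- The representation `V^S`: the span of the higher Specht polynomials `F_T^S` over all
bijective fillings `T` of the given cells. -/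
def VS (n : ℕ) (cells : Finset (ℕ × ℕ)) (S : Tab) : Submodule ℚ (MvPolynomial ℕ ℚ) :=
  Submodule.span ℚ {p | ∃ T : Tab, IsFillingF cells T ∧ p = FTS n T S}

/-- Multiplication of a subspace of polynomials by a fixed polynomial. -/
def polyMul (q : MvPolynomial ℕ ℚ) (V : Submodule ℚ (MvPolynomial ℕ ℚ)) :
    Submodule ℚ (MvPolynomial ℕ ℚ) :=
  Submodule.map (LinearMap.mulLeft ℚ q) V

/-- The symmetric multiplier `Π_r e_r^{h_r}`. -/
def eProd (n : ℕ) (h : ℕ → ℕ) : MvPolynomial ℕ ℚ := ∏ r ∈ Finset.Icc 1 n, esym n r ^ h r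

/-- `V^S_h := (Π_r e_r^{h_r}) V^S`. -/
def VSh (n : ℕ) (cells : Finset (ℕ × ℕ)) (S : Tab) (h : ℕ → ℕ) :
    Submodule ℚ (MvPolynomial ℕ ℚ) :=
  polyMul (eProd n h) (VS n cells S)

/-! ### The representations `R_{n,I}` -/

/-- For `i ∈ I`, `r_i := #{j ∈ {1,…,n-1} \ I : j < i}`. -/
def rIdxI (n : ℕ) (I : Finset ℕ) (i : ℕ) : ℕ :=
  ((Finset.Ioo 0 n \ I).filter fun j => j < i).card

/-- The vector `h^S_I`, whose `r`-th entry (for `r ≥ 1`) is `#{i ∈ I \ Dsi^c(S) : r_i = r}`. -/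
def hSI (n : ℕ) (I : Finset ℕ) (S : Tab) : ℕ → ℕ := fun r =>
  if 1 ≤ r then ((I \ Dsic n S).filter fun i => rIdxI n I i = r).card else 0

/-- The indicator vector `h(I,S)` of the set `I \ Dsi^c(S)`. -/
def hInd (n : ℕ) (I : Finset ℕ) (S : Tab) : ℕ → ℕ := fun r =>
  if r ∈ I \ Dsic n S then 1 else 0

/-- `F_{w,I} := F_w · Π_{i ∈ I \ Dsl(w)} e_{r_i}`. -/
def FwI (n : ℕ) (I : Finset ℕ) (w : Equiv.Perm ℕ) : MvPolynomial ℕ ℚ :=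
  Fw n w * ∏ i ∈ I \ DslSet n w, esym n (rIdxI n I i)

/-- The homogeneous version `F^hom_{w,I} := F_w · Π_{i ∈ I \ Dsl(w)} e_i`. -/
def FwIhom (n : ℕ) (I : Finset ℕ) (w : Equiv.Perm ℕ) : MvPolynomial ℕ ℚ :=
  Fw n w * ∏ i ∈ I \ DslSet n w, esym n i

/-- The representation `R_{n,I}`: span of the `F_{w,I}` over `w` with `Dsl(w) ⊆ I`. -/
def RnI (n : ℕ) (I : Finset ℕ) : Submodule ℚ (MvPolynomial ℕ ℚ) :=
  Submodule.span ℚ {p | ∃ w : Equiv.Perm ℕ, SuppIn n w ∧ DslSet n w ⊆ I ∧ p = FwI n I w}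

/-- The homogeneous representation `R^hom_{n,I}`. -/
def RnIhom (n : ℕ) (I : Finset ℕ) : Submodule ℚ (MvPolynomial ℕ ℚ) :=
  Submodule.span ℚ {p | ∃ w : Equiv.Perm ℕ, SuppIn n w ∧ DslSet n w ⊆ I ∧ p = FwIhom n I w}

/-- The index type for the decomposition of `R_{n,I}`: pairs of a partition `λ ⊢ n` and a
standard Young tableau `S` of shape `λ` with `Dsi^c(S) ⊆ I`. -/
def SIdx (n : ℕ) (I : Finset ℕ) : Type :=
  {q : YoungDiagram × Tab // q.1.cells.card = n ∧ IsStandard q.1 q.2 ∧ Dsic n q.2 ⊆ I}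

/-! ### Ordered set partitions -/

/-- The cumulative values `j_h` attached to a subset `I ⊆ {1,…,n-1}` (`j_0 = 0`,
`j_h` the `h`-th smallest element, `j_{|I|+1} = n`). -/
def jval (n : ℕ) (I : Finset ℕ) (h : ℕ) : ℕ :=
  if h = 0 then 0 else if h ≤ I.card then (I.sort (· ≤ ·)).getD (h - 1) 0 else n

/-- The composition `comp_n I`, as a function of the index `0 ≤ h ≤ |I|`. -/
def compFun (n : ℕ) (I : Finset ℕ) (h : ℕ) : ℕ := jval n I (h + 1) - jval n I h

/-- The set `OP_{n,I}` of ordered set partitions of `{1,…,n}` into `|I| + 1` blocks whose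
sizes are given by `comp_n I` (blocks indexed by `ℕ`, empty from index `|I| + 1` on). -/
def OPset (n : ℕ) (I : Finset ℕ) : Set (ℕ → Finset ℕ) :=
  {B | (∀ h, I.card + 1 ≤ h → B h = ∅) ∧
       (∀ h₁ h₂, h₁ ≠ h₂ → Disjoint (B h₁) (B h₂)) ∧
       (∀ h ≤ I.card, (B h).card = compFun n I h) ∧
       Finset.Icc 1 n = (Finset.range (I.card + 1)).biUnion B}

/-- The natural action of a permutation on an ordered set partition. -/
def permOP (w : Equiv.Perm ℕ) (B : ℕ → Finset ℕ) : ℕ → Finset ℕ := fun h => (B h).image w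

/-! ### The quotient `R_{n,k}` -/

/-- Elementary symmetric polynomials in `Fin n` variables. -/
def esymFin (n r : ℕ) : MvPolynomial (Fin n) ℚ :=
  ∑ s ∈ (Finset.univ : Finset (Fin n)).powersetCard r, ∏ i ∈ s, X i

/-- The ideal defining `R_{n,k}`: generated by `x_i^k` and `e_r`, `n-k+1 ≤ r ≤ n`. -/
def Jnk (n k : ℕ) : Ideal (MvPolynomial (Fin n) ℚ) :=
  Ideal.span ((Set.range fun i : Fin n => (X i : MvPolynomial (Fin n) ℚ) ^ k) ∪
    {p | ∃ r, n - k + 1 ≤ r ∧ r ≤ n ∧ p = esymFin n r})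

/-- The map sending `x_i` (for `1 ≤ i ≤ n`) to the corresponding variable of
`ℚ[x_1, …, x_n]`, and all other variables to `0`. -/
def toFin (n : ℕ) : MvPolynomial ℕ ℚ →ₐ[ℚ] MvPolynomial (Fin n) ℚ :=
  aeval fun i => if h : 1 ≤ i ∧ i ≤ n then X (⟨i - 1, by omega⟩ : Fin n) else 0

/-- The quotient projection onto `R_{n,k}`. -/
def projNK (n k : ℕ) : MvPolynomial ℕ ℚ →ₐ[ℚ] (MvPolynomial (Fin n) ℚ ⧸ Jnk n k) :=
  (Ideal.Quotient.mkₐ ℚ (Jnk n k)).comp (toFin n)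

/-! ### Corners, insertions and the induction/extension operators -/

/-- `v` is an external corner of `μ`. -/
def IsCorner (μ : YoungDiagram) (v : ℕ × ℕ) : Prop :=
  v ∉ μ.cells ∧ ∃ ν : YoungDiagram, ν.cells = insert v μ.cells

/-- `S +̃ v := ev (ev S + v)`, where `+ v` places the entry `n + 1` in the box `v`. -/
def Sadd (n : ℕ) (S : Tab) (v : ℕ × ℕ) : Tab :=
  evac (n + 1) (Function.update (evac n S) v (n + 1))

/-- `δ^{S,v}`: `0` if `v` lies strictly below the row of `n` in `ev S`, and `1` otherwise. -/
def deltaSV (n : ℕ) (S : Tab) (v : ℕ × ℕ) : ℕ :=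
  if rowIdx (evac n S) n < v.1 then 0 else 1

/-- `h + δ·1_t`: add `δ` to the coordinate `t` of `h` when `t ≥ 1`; do nothing for `t = 0`. -/
def addAt (h : ℕ → ℕ) (t δ : ℕ) : ℕ → ℕ := fun r =>
  if r = t ∧ 1 ≤ t then h r + δ else h r

/-- The induction operator on a single summand:
`Ind_t V^S_h := ⊕_{v ∈ EC(λ)} V^{S +̃ v}_{h + δ^{S,v}·1_t}`. -/
def IndVSh (t n : ℕ) (μ : YoungDiagram) (S : Tab) (h : ℕ → ℕ) :
    Submodule ℚ (MvPolynomial ℕ ℚ) :=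
  ⨆ v : ℕ × ℕ, ⨆ _ : IsCorner μ v,
    VSh (n + 1) (insert v μ.cells) (Sadd n S v) (addAt h t (deltaSV n S v))

/-- The extension operator on a single summand:
`Ext V^S_h := ⊕_{v ∈ EC(λ), δ^{S,v} = 1} V^{S +̃ v}_h`. -/
def ExtVSh (n : ℕ) (μ : YoungDiagram) (S : Tab) (h : ℕ → ℕ) :
    Submodule ℚ (MvPolynomial ℕ ℚ) :=
  ⨆ v : ℕ × ℕ, ⨆ _ : IsCorner μ v ∧ deltaSV n S v = 1,
    VSh (n + 1) (insert v μ.cells) (Sadd n S v) h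

/-- `Ind_t R_{n,I}`, applied summand-by-summand to the decomposition of `R_{n,I}`. -/
def IndR (t n : ℕ) (I : Finset ℕ) : Submodule ℚ (MvPolynomial ℕ ℚ) :=
  ⨆ q : SIdx n I, IndVSh t n q.1.1 q.1.2 (hSI n I q.1.2)

/-- `Ext R_{n,I}`, applied summand-by-summand. -/
def ExtR (n : ℕ) (I : Finset ℕ) : Submodule ℚ (MvPolynomial ℕ ℚ) :=
  ⨆ q : SIdx n I, ExtVSh n q.1.1 q.1.2 (hSI n I q.1.2)

/-- `Ind_t R^hom_{n,I}`, applied summand-by-summand. -/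
def IndRhom (t n : ℕ) (I : Finset ℕ) : Submodule ℚ (MvPolynomial ℕ ℚ) :=
  ⨆ q : SIdx n I, IndVSh t n q.1.1 q.1.2 (hInd n I q.1.2)

/-- `Ext R^hom_{n,I}`, applied summand-by-summand. -/
def ExtRhom (n : ℕ) (I : Finset ℕ) : Submodule ℚ (MvPolynomial ℕ ℚ) :=
  ⨆ q : SIdx n I, ExtVSh n q.1.1 q.1.2 (hInd n I q.1.2)

/-- The lift `R̃_{n,k} = ⊕_{|I| = k-1} R_{n,I}` of the quotient `R_{n,k}`. -/
def Rtil (n k : ℕ) : Submodule ℚ (MvPolynomial ℕ ℚ) :=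
  ⨆ I : Finset ℕ, ⨆ _ : I ⊆ Finset.Ioo 0 n ∧ I.card + 1 = k, RnI n I

/-! ### The extended column group -/

/-- The length of column `c` of a tableau. -/
def colLenT (n : ℕ) (T : Tab) (c : ℕ) : ℕ :=
  ((Finset.range (n + 1)).filter fun r => T (r, c) ≠ 0).card

/-- `q_a`: the number of columns of length `> a` (columns of length `a` occupy the
`0`-indexed columns `q_a, …, q_a + t_a - 1`). -/
def qaT (n : ℕ) (T : Tab) (a : ℕ) : ℕ :=
  ((Finset.range (n + 1)).filter fun c => a < colLenT n T c).card

/-- `t_a`: the number of columns of length `a`. -/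
def taT (n : ℕ) (T : Tab) (a : ℕ) : ℕ :=
  ((Finset.range (n + 1)).filter fun c => colLenT n T c = a).card

/-- The function underlying the permutation `η_T`: the entry in row `j` of column `q_a + i`
is sent to the entry in row `j` of column `q_a + η(i)`; everything else is fixed. -/
def etaFun (n : ℕ) (T : Tab) (a : ℕ) (η : Equiv.Perm ℕ) : ℕ → ℕ := fun m =>
  let c := colIdx T m
  if 1 ≤ m ∧ m ≤ n ∧ qaT n T a ≤ c ∧ c < qaT n T a + taT n T a then
    T (rowIdx T m, qaT n T a + η (c - qaT n T a))
  else m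

/-- The set of the permutations `η_T` (over all `a ≥ 1` and all `η ∈ S_{t_a}`). -/
def etaSet (n : ℕ) (T : Tab) : Set (Equiv.Perm ℕ) :=
  {w | ∃ a, 1 ≤ a ∧ ∃ η : Equiv.Perm ℕ, (∀ i, taT n T a ≤ i → η i = i) ∧
    ⇑w = etaFun n T a η}

/-- The subgroup generated by the permutations `η_T` (a copy of `Π_a S_{t_a}`). -/
def etaSubgroup (n : ℕ) (T : Tab) : Subgroup (Equiv.Perm ℕ) :=
  Subgroup.closure (etaSet n T)

/-- The column group `C(T)` as a subgroup. -/
def colSubgroup (n : ℕ) (T : Tab) : Subgroup (Equiv.Perm ℕ) :=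
  Subgroup.closure (colGroupSet n T)

/-- The extended column group `C̃(T)`, generated by `C(T)` and the `η_T`. -/
def extColSubgroup (n : ℕ) (T : Tab) : Subgroup (Equiv.Perm ℕ) :=
  Subgroup.closure (colGroupSet n T ∪ etaSet n T)

/-- The sign of a permutation of `ℕ` supported on `{1, …, n}`. -/
def signOn (n : ℕ) (σ : Equiv.Perm ℕ) : ℤ :=
  if h : ∃ τ : Equiv.Perm (Fin n), embedPerm n τ = σ then
    (Equiv.Perm.sign h.choose : ℤ) else 0

/-! ### Semistandard tableaux, (generalized) cocharge tableaux -/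

/-- A semistandard filling of the given cells: rows weakly increase, columns strictly
increase (entries outside the cells are normalized to `0`). -/
def IsSSYTOn (cells : Finset (ℕ × ℕ)) (C : Tab) : Prop :=
  (∀ c ∉ cells, C c = 0) ∧
  (∀ c₁ ∈ cells, ∀ c₂ ∈ cells, c₁.1 = c₂.1 → c₁.2 ≤ c₂.2 → C c₁ ≤ C c₂) ∧
  (∀ c₁ ∈ cells, ∀ c₂ ∈ cells, c₁.2 = c₂.2 → c₁.1 < c₂.1 → C c₁ < C c₂)

/-- A generalized cocharge tableau with entries exactly `{0, …, k-1}`. -/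
def IsGCT (cells : Finset (ℕ × ℕ)) (C : Tab) (k : ℕ) : Prop :=
  IsSSYTOn cells C ∧ (∀ c ∈ cells, C c < k) ∧ ∀ h < k, ∃ c ∈ cells, C c = h

/-- The type of a generalized cocharge tableau: the set of cumulative multiplicities
`#{c : C c < h}` for `1 ≤ h ≤ k - 1`. -/
def gctType (cells : Finset (ℕ × ℕ)) (C : Tab) (k : ℕ) : Finset ℕ :=
  (Finset.Ico 1 k).image fun h => (cells.filter fun c => C c < h).card

/-- The standardization of a semistandard tableau: entries are replaced by `1, …, n`,
processing the values in increasing order and, for equal values, from left to right. -/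
def stdz (cells : Finset (ℕ × ℕ)) (C : Tab) : Tab := fun c =>
  if c ∈ cells then
    (cells.filter fun c' => C c' < C c ∨
      (C c' = C c ∧ (c'.2 < c.2 ∨ (c'.2 = c.2 ∧ c'.1 ≤ c.1)))).card
  else 0

/-- A cocharge tableau of shape `μ`: one of the form `ct S` for a standard `S`. -/
def IsCCT (μ : YoungDiagram) (C : Tab) : Prop :=
  ∃ S : Tab, IsStandard μ S ∧ ctTab μ.cells.card S = C

/-- `k` for a tableau: one more than the maximal entry. -/
def kOf (cells : Finset (ℕ × ℕ)) (C : Tab) : ℕ := cells.sup C + 1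

/-- `Dsp^c(C) := {n - i : i ∈ J}`, `J` the type of the cocharge tableau `C`. -/
def Dspc (n : ℕ) (cells : Finset (ℕ × ℕ)) (C : Tab) : Finset ℕ :=
  (gctType cells C (kOf cells C)).image fun i => n - i

/-- The entry sum `Σ(C)`. -/
def entrySum (cells : Finset (ℕ × ℕ)) (C : Tab) : ℕ := ∑ c ∈ cells, C c

/-- `C +̂ v := ct (ct⁻¹(C) +̃ v)`, where `ct⁻¹` is the standardization. -/
def Cadd (n : ℕ) (μ : YoungDiagram) (C : Tab) (v : ℕ × ℕ) : Tab :=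
  ctTab (n + 1) (Sadd n (stdz μ.cells C) v)

/-- The standard Young tableau `S⁰` of shape `μ` filling the rows consecutively. -/
def rowWordTab (μ : YoungDiagram) : Tab := fun c =>
  if c ∈ μ.cells then (∑ r ∈ Finset.range c.1, μ.rowLen r) + c.2 + 1 else 0

/-- The word of an ordered set partition: the blocks listed in order, each sorted
increasingly. -/
def opWord (k : ℕ) (B : ℕ → Finset ℕ) : List ℕ :=
  (List.range k).foldr (fun h acc => (B h).sort (· ≤ ·) ++ acc) []

/-- Renaming the variables of a power series along a permutation. -/
def permSeries (g : Equiv.Perm ℕ) (F : MvPowerSeries ℕ ℚ) : MvPowerSeries ℕ ℚ :=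
  fun m => F (Finsupp.mapDomain ⇑g⁻¹ m)


/-! ### Part A: words of cells, sliding, evacuation -/

def Low (μ : Finset (ℕ × ℕ)) : Prop :=
  ∀ r c r' c', (r, c) ∈ μ → r' ≤ r → c' ≤ c → (r', c') ∈ μ

def Valid : Finset (ℕ × ℕ) → List (ℕ × ℕ) → Prop
  | μ, [] => Low μ
  | μ, a :: l => Low μ ∧ a ∉ μ ∧ Valid (insert a μ) l

def adj (h a : ℕ × ℕ) : Prop := a = (h.1, h.2 + 1) ∨ a = (h.1 + 1, h.2)

theorem Valid.low {μ l} (h : Valid μ l) : Low μ := by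
  cases l with
  | nil => exact h
  | cons a l => exact h.1

theorem adj_of_le {μ : Finset (ℕ × ℕ)} {h a : ℕ × ℕ} (h1 : Low μ) (h2 : h ∉ μ)
    (h4 : Low (insert a (insert h μ))) (hne : a ≠ h)
    (hl1 : h.1 ≤ a.1) (hl2 : h.2 ≤ a.2) : adj h a := by
  obtain ⟨x, y⟩ := h
  obtain ⟨z, t⟩ := a
  simp only [adj, Prod.mk.injEq, ne_eq, not_and, Finset.mem_insert, not_or] at *
  by_contra hc
  push Not at hc
  by_cases hx : x = z
  · subst hx
    have ht : y + 1 < t := by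
      rcases Nat.lt_or_ge (y+1) t with h | h
      · exact h
      · exfalso
        have : t = y + 1 ∨ t = y := by omega
        rcases this with h | h
        · exact hc.1 rfl h
        · exact hne rfl h
    have := h4 x t x (y+1) (by simp) le_rfl (by omega)
    simp only [Finset.mem_insert, Prod.mk.injEq] at this
    rcases this with h | h | h
    · omega
    · omega
    · exact h2 (h1 _ _ _ _ h le_rfl (by omega))
  · have := h4 z t (x+1) y (by simp) (by omega) (by omega)
    simp only [Finset.mem_insert, Prod.mk.injEq] at this
    rcases this with h | h | h
    · exact hc.2 h.1.symm h.2.symm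
    · omega
    · exact h2 (h1 _ _ _ _ h (by omega) le_rfl)

theorem not_adj_rev {μ : Finset (ℕ × ℕ)} {h a : ℕ × ℕ} (h2 : a ∉ μ)
    (h4 : Low (insert h μ)) (hne : a ≠ h) : ¬ adj a h := by
  rintro (e | e) <;>
  · have := h4 h.1 h.2 a.1 a.2 (by simp) (by simp [e]) (by simp [e])
    simp only [Prod.mk.eta, Finset.mem_insert] at this
    tauto

theorem same_row {μ : Finset (ℕ × ℕ)} {h a : ℕ × ℕ} (h1 : Low μ) (h2 : h ∉ μ) (h3 : a ∉ μ)
    (h4 : Low (insert h μ)) (h5 : Low (insert a (insert h μ))) (hne : a ≠ h) (hr : h.1 = a.1) :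
    adj h a := by
  apply adj_of_le h1 h2 h5 hne hr.le
  by_contra hc
  have := h4 h.1 h.2 a.1 a.2 (by simp) hr.ge (by omega)
  simp only [Prod.mk.eta, Finset.mem_insert] at this
  tauto

theorem low_swap {μ : Finset (ℕ × ℕ)} {h a : ℕ × ℕ} (h1 : Low μ) (h2 : h ∉ μ)
    (h5 : Low (insert a (insert h μ))) (hne : a ≠ h) (hn : ¬ adj h a) : Low (insert a μ) := by
  intro r c r' c' hm hr hc
  rw [Finset.mem_insert] at hm ⊢
  rcases hm with rfl | hm
  · have := h5 r c r' c' (by simp) hr hc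
    simp only [Finset.mem_insert] at this
    rcases this with h | h | h
    · exact Or.inl h
    · exfalso
      subst h
      exact hn (adj_of_le h1 h2 h5 hne hr hc)
    · exact Or.inr h
  · exact Or.inr (h1 _ _ _ _ hm hr hc)

theorem valid_swap {μ : Finset (ℕ × ℕ)} {h a : ℕ × ℕ} {l} (hv : Valid μ (h :: a :: l))
    (hn : ¬ adj h a) : Valid μ (a :: h :: l) := by
  obtain ⟨h1, h2, h3, h4, h5⟩ := hv
  simp only [Finset.mem_insert, not_or] at h4
  refine ⟨h1, h4.2, low_swap h1 h2 h5.low h4.1 hn, ?_, ?_⟩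
  · simp only [Finset.mem_insert, not_or]; exact ⟨fun h => h4.1 h.symm, h2⟩
  · rw [Finset.insert_comm]; exact h5

/-- sliding a hole through a word of cells -/
def sl : ℕ × ℕ → List (ℕ × ℕ) → List (ℕ × ℕ) × (ℕ × ℕ)
  | h, [] => ([], h)
  | h, a :: l => if adj h a then (h :: (sl a l).1, (sl a l).2) else (a :: (sl h l).1, (sl h l).2)

theorem sl_length (h l) : (sl h l).1.length = l.length := by
  induction l generalizing h with
  | nil => rfl
  | cons a l ih => simp only [sl]; split <;> simp [ih]

theorem sl_valid {μ h l} (hv : Valid μ (h :: l)) : Valid μ ((sl h l).1 ++ [(sl h l).2]) := by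
  induction l generalizing h μ with
  | nil => exact hv
  | cons a l ih =>
    simp only [sl]; split
    · rename_i hc
      exact ⟨hv.1, hv.2.1, ih hv.2.2⟩
    · rename_i hc
      have := valid_swap hv hc
      exact ⟨this.1, this.2.1, ih this.2.2⟩

theorem sl_toFinset (h l) : ((sl h l).1 ++ [(sl h l).2]).toFinset = (h :: l).toFinset := by
  induction l generalizing h with
  | nil => rfl
  | cons a l ih =>
    simp only [sl]; split
    · simp only [List.cons_append, List.toFinset_cons, ih]
    · simp only [List.cons_append, List.toFinset_cons, ih, Finset.insert_comm a h]

/-- descent list -/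
def dl : List (ℕ × ℕ) → List Prop
  | [] => []
  | [_] => []
  | a :: b :: l => (a.1 < b.1) :: dl (b :: l)

theorem triple1 {μ h a b l} (hv : Valid μ (h :: a :: b :: l)) (h' a' b' : ℕ × ℕ)
    (e1 : (a', h') = if adj h a then (h, a) else (a, h))
    (e2 : b' = if adj h' b then h' else b) : (a'.1 < b'.1) = (a.1 < b.1) := by
  obtain ⟨h1, h2, h3, h4, h5, h6, h7⟩ := hv
  have h7 := h7.low
  simp only [Finset.mem_insert, not_or] at h4 h6
  by_cases c1 : adj h a
  · rw [if_pos c1] at e1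
    obtain ⟨rfl, rfl⟩ := Prod.mk.inj e1
    have sr := same_row (μ := insert a' μ) (h := h') (a := b) h3 (by simp [h4])
      (by simp [h6]) h5 h7 h6.1
    by_cases c2 : adj h' b
    · rw [if_pos c2] at e2
      subst e2
      apply propext
      have ca : b ≠ (a'.1 + 1, a'.2 + 1) := by
        rintro rfl
        have p1 := h7 _ _ (a'.1 + 1) a'.2 (Finset.mem_insert_self _ _) le_rfl (by simp)
        have p2 := h7 _ _ a'.1 (a'.2 + 1) (Finset.mem_insert_self _ _) (by simp) le_rfl
        simp only [Finset.mem_insert] at p1 p2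
        have n1 : (a'.1 + 1, a'.2) ∉ μ := fun hh => h2 (h1 _ _ _ _ hh (by simp) le_rfl)
        have n2 : (a'.1, a'.2 + 1) ∉ μ := fun hh => h2 (h1 _ _ _ _ hh le_rfl (by simp))
        have q1 : (a'.1 + 1, a'.2) = b' := by
          rcases p1 with p | p | p | p
          · simp at p
          · exact p
          · exact absurd (congrArg Prod.fst p) (by simp)
          · exact absurd p n1
        have q2 : (a'.1, a'.2 + 1) = b' := by
          rcases p2 with p | p | p | p
          · simp at p
          · exact p
          · exact absurd (congrArg Prod.snd p) (by simp)
          · exact absurd p n2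
        rw [← q2] at q1
        simp at q1
      rcases c1 with c1 | c1 <;> rcases c2 with c2 | c2
      · simp [c2, c1]
      · exfalso; apply ca; rw [c2, c1]
      · exfalso; apply ca; rw [c2, c1]
      · simp [c2, c1]
    · rw [if_neg c2] at e2
      subst e2
      have : h'.1 ≠ b'.1 := fun h => c2 (sr h)
      apply propext
      rcases c1 with c1 | c1 <;> rw [c1] at this ⊢ <;> simp at this ⊢
      omega
  · rw [if_neg c1] at e1
    obtain ⟨rfl, rfl⟩ := Prod.mk.inj e1
    by_cases c2 : adj h' b
    · rw [if_pos c2] at e2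
      subst e2
      have : b'.1 ≠ a'.1 := fun h => c1 (same_row h1 h2 h4.2 h3 h5 h4.1 h)
      apply propext
      rcases c2 with c2 | c2 <;> rw [c2] <;> simp
      omega
    · rw [if_neg c2] at e2
      subst e2; rfl

theorem dl_sl {μ h l} (hv : Valid μ (h :: l)) : dl (sl h l).1 = dl l := by
  induction l generalizing h μ with
  | nil => rfl
  | cons a l ih =>
    cases l with
    | nil => simp only [sl]; split <;> rfl
    | cons b l =>
      have T := triple1 hv
      by_cases c1 : adj h a
      · have I := ih hv.2.2
        have T := T a h _ (by rw [if_pos c1]) rfl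
        simp only [sl, if_pos c1] at I ⊢
        split
        all_goals
          rename_i c2
          simp only [c2, if_true, if_false] at I T
          simp only [dl]
          first | rw [I, T] | rw [I]
      · have I := ih (valid_swap hv c1).2.2
        have T := T h a _ (by rw [if_neg c1]) rfl
        simp only [sl, if_neg c1] at I ⊢
        split
        all_goals
          rename_i c2
          simp only [c2, if_true, if_false] at I T
          simp only [dl]
          first | rw [I, T] | rw [I]

/-- two successive holes keep their relative position -/
theorem two_holes {μ g h l} (hv : Valid μ (g :: h :: l)) :
    ((sl g (sl h l).1).2.1 < (sl h l).2.1) = (g.1 < h.1) := by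
  induction l generalizing μ g h with
  | nil => rfl
  | cons a l ih =>
    -- rewrite as inverse triple
    obtain ⟨v1, v2, v3⟩ := hv
    by_cases c1 : adj h a
    · have v4 : Valid μ (g :: h :: a :: l) := ⟨v1, v2, v3⟩
      simp only [sl, if_pos c1]
      by_cases c2 : adj g h
      · simp only [sl, if_pos c2]
        rw [ih v3]
        -- (g,h,a): adjacent both
        have := triple1 v4 h g h (by rw [if_pos c2]) (by rw [if_pos c1])
        exact this.symm
      · simp only [sl, if_neg c2]
        have v5 := valid_swap v4 c2
        rw [ih v5.2.2]
        have nr := not_adj_rev v5.2.1 v3.low (fun e => v3.2.1 (by simp [e]))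
        have := triple1 v5 h g h (by rw [if_neg nr]) (by rw [if_pos c1])
        exact this.symm
    · have v4 : Valid μ (g :: a :: h :: l) := ⟨v1, v2, valid_swap v3 c1⟩
      simp only [sl, if_neg c1]
      by_cases c2 : adj g a
      · simp only [sl, if_pos c2]
        rw [ih v4.2.2]
        have nr : ¬ adj a h := not_adj_rev v4.2.2.2.1 v3.2.2.low
          (fun e => v4.2.2.2.2.2.1 (by simp [e]))
        have := triple1 v4 a g h (by rw [if_pos c2]) (by rw [if_neg nr])
        exact this.symm
      · simp only [sl, if_neg c2]
        have v5 := valid_swap v4 c2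
        rw [ih v5.2.2]

/-! ### Part B: evacuation on words -/

theorem valid_append {μ l1 l2} : Valid μ (l1 ++ l2) ↔ Valid μ l1 ∧ Valid (l1.toFinset ∪ μ) l2 := by
  induction l1 generalizing μ with
  | nil => simp [Valid]; exact fun h => h.low
  | cons a l ih =>
    simp only [List.cons_append, Valid, ih, List.toFinset_cons]
    have : insert a l.toFinset ∪ μ = l.toFinset ∪ insert a μ := by
      ext; simp
    rw [this]
    tauto

theorem Valid.nodup {μ l} (h : Valid μ l) : l.Nodup ∧ ∀ a ∈ l, a ∉ μ := by
  induction l generalizing μ with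
  | nil => simp
  | cons a l ih =>
    obtain ⟨h1, h2, h3⟩ := h
    have := ih h3
    simp only [List.nodup_cons, List.mem_cons, forall_eq_or_imp]
    refine ⟨⟨fun hh => this.2 a hh (by simp), this.1⟩, h2, fun b hb hh => this.2 b hb (by simp [hh])⟩

def evW : ℕ → List (ℕ × ℕ) → List (ℕ × ℕ)
  | 0, _ => []
  | _ + 1, [] => []
  | m + 1, a :: l => evW m (sl a l).1 ++ [(sl a l).2]

theorem evW_length (m l) (h : l.length = m) : (evW m l).length = m := by
  induction m generalizing l with
  | zero => rfl
  | succ m ih =>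
    cases l with
    | nil => simp at h
    | cons a l =>
      simp only [evW, List.length_append, List.length_singleton]
      rw [ih]; rw [sl_length]; simpa using h

theorem evW_toFinset (m l) (h : l.length = m) : (evW m l).toFinset = l.toFinset := by
  induction m generalizing l with
  | zero => simp at h; simp [h, evW]
  | succ m ih =>
    cases l with
    | nil => simp at h
    | cons a l =>
      have := sl_toFinset a l
      rw [List.toFinset_append] at this
      simp only [evW, List.toFinset_append]
      rw [ih _ (by rw [sl_length]; simpa using h), this]

theorem evW_valid (m l) (h : l.length = m) (hv : Valid ∅ l) : Valid ∅ (evW m l) := by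
  induction m generalizing l with
  | zero => simp at h; subst h; exact hv
  | succ m ih =>
    cases l with
    | nil => simp at h
    | cons a l =>
      have := sl_valid hv
      rw [valid_append] at this
      simp only [evW, valid_append]
      have e : (sl a l).1.length = m := by rw [sl_length]; simpa using h
      refine ⟨ih _ e this.1, ?_⟩
      rw [evW_toFinset _ _ e]; exact this.2

theorem dl_snoc (l a b) : dl (l ++ [a] ++ [b]) = dl (l ++ [a]) ++ [(a.1 < b.1 : Prop)] := by
  induction l with
  | nil => rfl
  | cons c l ih =>
    cases l with
    | nil => rfl
    | cons d l => simp only [List.cons_append, dl] at ih ⊢; rw [ih]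

theorem valid_head {a l} (h : Valid ∅ (a :: l)) : a = (0, 0) := by
  have := h.2.2.low a.1 a.2 0 0 (by simp) (by simp) (by simp)
  simpa [eq_comm] using this

theorem valid_second {a b l} (h : Valid ∅ (a :: b :: l)) : adj a b := by
  have h0 := valid_head h
  obtain ⟨h1, h2, h3, h4, h5⟩ := h
  apply adj_of_le h1 h2 h5.low
  · intro e; apply h4; simp [e]
  · simp [h0]
  · simp [h0]

theorem evW_dl (m l) (h : l.length = m) (hv : Valid ∅ l) : dl (evW m l) = (dl l).reverse := by
  induction m generalizing l with
  | zero => simp at h; subst h; rfl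
  | succ m ih =>
    cases l with
    | nil => simp at h
    | cons a l =>
      cases l with
      | nil => simp at h; subst h; rfl
      | cons b l =>
        obtain ⟨m, rfl⟩ : ∃ m', m = m' + 1 := ⟨l.length, by simpa using h.symm⟩
        have c := valid_second hv
        have e : (sl a (b :: l)).1.length = m + 1 := by rw [sl_length]; simpa using h
        have v1 : Valid ∅ (sl a (b :: l)).1 := (valid_append.1 (sl_valid hv)).1
        have I := ih _ e v1
        rw [dl_sl hv] at I
        have T := two_holes hv
        simp only [evW, sl, if_pos c] at I ⊢
        rw [dl_snoc, I, T]
        simp [dl]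

theorem sl_surj (μ b h) (hv : Valid μ (b ++ [h])) :
    ∃ a l, Valid μ (a :: l) ∧ sl a l = (b, h) := by
  induction b generalizing μ with
  | nil => exact ⟨h, [], hv, rfl⟩
  | cons c b ih =>
    obtain ⟨h1, h2, h3⟩ := hv
    obtain ⟨a, l, h4, h5⟩ := ih _ h3
    by_cases hc : adj c a
    · exact ⟨c, a :: l, ⟨h1, h2, h4⟩, by simp [sl, hc, h5]⟩
    · have hw : Valid μ (c :: a :: l) := ⟨h1, h2, h4⟩
      have hw' := valid_swap hw hc
      have nr := not_adj_rev hw'.2.1 h4.low (fun e => h4.2.1 (by simp [e]))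
      exact ⟨a, c :: l, hw', by simp [sl, nr, h5]⟩

theorem evW_surj (m q) (h : q.length = m) (hv : Valid ∅ q) :
    ∃ s, s.length = m ∧ Valid ∅ s ∧ evW m s = q := by
  induction m generalizing q with
  | zero => simp at h; subst h; exact ⟨[], rfl, hv, rfl⟩
  | succ m ih =>
    obtain ⟨q', v, rfl⟩ : ∃ q' v, q = q' ++ [v] := by
      rcases List.eq_nil_or_concat q with rfl | ⟨q', v, rfl⟩
      · simp at h
      · exact ⟨q', v, by simp⟩
    rw [valid_append] at hv
    obtain ⟨s, h1, h2, h3⟩ := ih q' (by simpa using h) hv.1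
    have : Valid ∅ (s ++ [v]) := by
      rw [valid_append]
      refine ⟨h2, ?_⟩
      rw [← evW_toFinset m s h1, h3]; exact hv.2
    obtain ⟨a, l, h4, h5⟩ := sl_surj _ _ _ this
    refine ⟨a :: l, ?_, h4, ?_⟩
    · have := sl_length a l
      rw [h5] at this; simp [← this, h1]
    · simp [evW, h5, h3]

def tabOf (l : List (ℕ × ℕ)) : Tab := fun c => if c ∈ l then l.idxOf c + 1 else 0

theorem slide_eq (l h) (G : Tab) (μ off fuel) (hv : Valid μ (h :: l)) (hf : l.length ≤ fuel)
    (hG : ∀ c, c ∉ μ → G c = if c ∈ l then off + l.idxOf c + 1 else 0) :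
    slide fuel G h = (fun c => if c ∈ μ then G c else if c ∈ (sl h l).1 then
      off + (sl h l).1.idxOf c + 1 else 0, (sl h l).2) := by
  have hr : (h.1, h.2 + 1) ∉ μ := fun hh => hv.2.1 (hv.1 _ _ _ _ hh le_rfl (by simp))
  have hd : (h.1 + 1, h.2) ∉ μ := fun hh => hv.2.1 (hv.1 _ _ _ _ hh (by simp) le_rfl)
  induction l generalizing h G μ off fuel with
  | nil =>
    have e : slide fuel G h = (G, h) := by
      cases fuel with
      | zero => rfl
      | succ f =>
        have : slideOnce G h = (G, h) := by
          simp [slideOnce, hG _ hr, hG _ hd]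
        simp [slide, this]
    rw [e]
    simp only [sl, List.not_mem_nil, if_false, Prod.mk.injEq, and_true]
    funext c
    split
    · rfl
    · rename_i hc
      simp [hG _ hc]
  | cons a l ih =>
    have hnd := hv.nodup
    have hal : a ∉ l := by have := hnd.1; simp at this; exact this.2.1
    have haμ : a ∉ μ := hnd.2 a (by simp)
    have hah : a ≠ h := by have := hnd.1; simp at this; exact fun e => this.1.1 e.symm
    have hhl : h ∉ l := by have := hnd.1; simp at this; exact this.1.2
    have hhμ : h ∉ μ := hv.2.1
    by_cases hc : adj h a
    · cases fuel with
      | zero => simp at hf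
      | succ f =>
        have ho : slideOnce G h = (Function.update (Function.update G h (G a)) a 0, a) := by
          have ga : G a = off + 1 := by rw [hG _ haμ]; simp
          have key : ∀ b, b ∉ μ → b ≠ a → G b = 0 ∨ off + 1 < G b := by
            intro b hb hba
            rw [hG b hb]
            split
            · right
              rw [List.idxOf_cons_ne _ (Ne.symm hba)]
              omega
            · left; rfl
          rcases hc with hc | hc
          · have k := key (h.1 + 1, h.2) hd (by rw [hc]; simp)
            rw [hc] at ga
            rw [slideOnce]
            simp only [ga, hc]
            rcases k with k | k
            · simp [k]
            · simp [k]
          · have k := key (h.1, h.2 + 1) hr (by rw [hc]; simp)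
            rw [hc] at ga
            rw [slideOnce]
            simp only [ga, hc]
            rcases k with k | k
            · simp [k]
            · have : ¬ (G (h.1, h.2 + 1) < off + 1) := by omega
              simp [this]
        have hv' := hv.2.2
        rw [slide, ho]
        simp only [if_neg hah]
        rw [ih a _ (insert h μ) (off + 1) f hv' (by simpa using hf) ?_ ?_ ?_]
        · simp only [sl, if_pos hc, Prod.mk.injEq, and_true]
          funext c
          by_cases c1 : c = h
          · subst c1
            have ga : G a = off + 1 := by rw [hG _ haμ]; simp
            simp [hhμ, Function.update_of_ne (Ne.symm hah), ga]
          · by_cases c2 : c ∈ μ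
            · have : c ≠ a := by rintro rfl; exact haμ c2
              simp [c2, this, c1]
            · simp [c1, c2, List.idxOf_cons_ne _ (Ne.symm c1)]
              congr 1; omega
        · intro c hcm
          simp only [Finset.mem_insert, not_or] at hcm
          by_cases c1 : c = a
          · subst c1; simp [hal]
          · simp only [Function.update_of_ne c1, Function.update_of_ne hcm.1, hG c hcm.2,
              List.mem_cons, c1, false_or, List.idxOf_cons_ne _ (Ne.symm c1)]
            congr 1; simp; omega
        · intro hh
          exact hv'.2.1 (hv'.1 _ _ _ _ hh le_rfl (by simp))
        · intro hh
          exact hv'.2.1 (hv'.1 _ _ _ _ hh (by simp) le_rfl)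
    · have hw := (valid_swap hv hc).2.2
      rw [ih h G (insert a μ) (off + 1) fuel hw (by simp at hf; omega) ?_ ?_ ?_]
      · simp only [sl, if_neg hc, Prod.mk.injEq, and_true]
        funext c
        by_cases c1 : c = a
        · subst c1
          have ga : G c = off + 1 := by rw [hG _ haμ]; simp
          simp [haμ, ga]
        · by_cases c2 : c ∈ μ
          · simp [c2]
          · simp [c1, c2, List.idxOf_cons_ne _ (Ne.symm c1)]
            congr 1; omega
      · intro c hcm
        simp only [Finset.mem_insert, not_or] at hcm
        simp only [hG c hcm.2, List.mem_cons, hcm.1, false_or, 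
              List.idxOf_cons_ne _ (Ne.symm hcm.1)]
        congr 1; simp; omega
      · intro hh
        exact hw.2.1 (hw.1 _ _ _ _ hh le_rfl (by simp))
      · intro hh
        exact hw.2.1 (hw.1 _ _ _ _ hh (by simp) le_rfl)

theorem tabOf_eq_iff {l : List (ℕ × ℕ)} (hn : l.Nodup) (c : ℕ × ℕ) (i : ℕ) :
    tabOf l c = i + 1 ↔ l[i]? = some c := by
  unfold tabOf
  constructor
  · intro h
    split at h
    · rename_i hc
      have : l.idxOf c = i := by omega
      subst this
      rw [List.getElem?_eq_getElem (List.idxOf_lt_length_iff.2 hc)]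
      simp
    · omega
  · intro h
    obtain ⟨hi, rfl⟩ := List.getElem?_eq_some_iff.1 h
    simp [hn.idxOf_getElem]

theorem rowIdx_tabOf {l : List (ℕ × ℕ)} (hn : l.Nodup) (i : ℕ) (c) (h : l[i]? = some c) :
    rowIdx (tabOf l) (i + 1) = c.1 := by
  have : {r | ∃ d, tabOf l (r, d) = i + 1} = {c.1} := by
    ext r
    simp only [tabOf_eq_iff hn, h, Set.mem_setOf_eq, Set.mem_singleton_iff, Option.some.injEq]
    constructor
    · rintro ⟨d, rfl⟩; rfl
    · rintro rfl; exact ⟨c.2, rfl⟩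
  rw [rowIdx, this]; simp

theorem colIdx_tabOf {l : List (ℕ × ℕ)} (hn : l.Nodup) (i : ℕ) (c) (h : l[i]? = some c) :
    colIdx (tabOf l) (i + 1) = c.2 := by
  have : {d | tabOf l (rowIdx (tabOf l) (i + 1), d) = i + 1} = {c.2} := by
    rw [rowIdx_tabOf hn i c h]
    ext r
    simp only [tabOf_eq_iff hn, h, Set.mem_setOf_eq, Set.mem_singleton_iff, Option.some.injEq,
      Prod.ext_iff, true_and]
    exact eq_comm
  rw [colIdx, this]; simp

theorem tabOf_snoc (l : List (ℕ × ℕ)) (v) (hv : v ∉ l) :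
    tabOf (l ++ [v]) = Function.update (tabOf l) v (l.length + 1) := by
  funext c
  by_cases hc : c = v
  · subst hc; simp [tabOf, hv, List.idxOf_append]
  · simp only [Function.update_of_ne hc, tabOf, List.mem_append, List.mem_singleton, hc, or_false]
    by_cases h : c ∈ l
    · simp [h, List.idxOf_append]
    · simp [h]

theorem evac_tabOf (m l) (h : l.length = m) (hv : Valid ∅ l) :
    evacAux m (tabOf l) = tabOf (evW m l) := by
  induction m generalizing l with
  | zero => funext c; simp [evacAux, evW, tabOf]
  | succ m ih =>
    cases l with
    | nil => simp at h
    | cons a l =>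
      have hnd := hv.nodup.1
      have hp : posOf (tabOf (a :: l)) 1 = a := by
        unfold posOf
        rw [rowIdx_tabOf hnd 0 a (by simp), colIdx_tabOf hnd 0 a (by simp)]
      have hs := slide_eq l a (Function.update (tabOf (a :: l)) a 0) ∅ 1 (m + 1) hv
        (by simp at h; omega) (by
          intro c _
          have hal : a ∉ l := by simp at hnd; exact hnd.1
          by_cases c1 : c = a
          · subst c1; simp [hal]
          · simp only [Function.update_of_ne c1, tabOf, List.mem_cons, c1, false_or,
              List.idxOf_cons_ne _ (Ne.symm c1)]
            congr 1; simp; omega)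
      simp only [evacAux, hp, hs, evW]
      have e : (sl a l).1.length = m := by rw [sl_length]; simpa using h
      have v1 := sl_valid hv
      have hE : (fun c => (if c ∈ (∅ : Finset (ℕ × ℕ)) then
          Function.update (tabOf (a :: l)) a 0 c else if c ∈ (sl a l).1 then
          1 + (sl a l).1.idxOf c + 1 else 0) - 1) = tabOf (sl a l).1 := by
        funext c
        simp only [tabOf, Finset.notMem_empty, if_false]
        split
        · omega
        · rfl
      rw [hE, ih _ e (valid_append.1 v1).1, tabOf_snoc, evW_length _ _ e]
      have nd := v1.nodup.1
      rw [← List.mem_toFinset, evW_toFinset _ _ e, List.mem_toFinset]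
      intro hh
      rw [List.nodup_append] at nd
      exact nd.2.2 _ hh _ (by simp) rfl

/-! ### Part C: standard tableaux and words, descents -/

def toYD (s : Finset (ℕ × ℕ)) (h : Low s) : YoungDiagram where
  cells := s
  isLowerSet := by
    rintro ⟨a, b⟩ ⟨c, d⟩ hle hm
    exact h a b c d hm hle.1 hle.2

theorem low_YD (μ : YoungDiagram) : Low μ.cells := by
  intro r c r' c' hm hr hc
  exact μ.isLowerSet (show ((r', c') : ℕ × ℕ) ≤ (r, c) from ⟨hr, hc⟩) hm

theorem low_empty : Low ∅ := by intro r c r' c' h; simp at h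

theorem Valid.low_toFinset {l} (h : Valid ∅ l) : Low l.toFinset := by
  have : Valid ∅ (l ++ []) := by simpa using h
  rw [valid_append] at this
  simpa [Valid] using this.2

theorem standard_exists_word {μ : YoungDiagram} {T : Tab} (hT : IsStandard μ T) :
    ∃ l, Valid ∅ l ∧ l.toFinset = μ.cells ∧ l.length = μ.cells.card ∧ T = tabOf l := by
  obtain ⟨⟨h0, hb⟩, hs⟩ := hT
  set n := μ.cells.card with hn
  have hex : ∀ i, ∃ c, i < n → c ∈ μ.cells ∧ T c = i + 1 := by
    intro i
    by_cases hi : i < n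
    · obtain ⟨c, hc, hc'⟩ := hb.surjOn (show i + 1 ∈ Set.Icc 1 n from ⟨by omega, by omega⟩)
      exact ⟨c, fun _ => ⟨hc, hc'⟩⟩
    · exact ⟨(0, 0), fun h => absurd h hi⟩
  choose g hg using hex
  have hmem : ∀ k ≤ n, ∀ c, c ∈ ((List.range k).map g).toFinset ↔ c ∈ μ.cells ∧ T c ≤ k := by
    intro k hk c
    simp only [List.mem_toFinset, List.mem_map, List.mem_range]
    constructor
    · rintro ⟨i, hi, rfl⟩
      have := hg i (by omega)
      exact ⟨this.1, by omega⟩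
    · rintro ⟨h1, h2⟩
      have h3 := hb.mapsTo h1
      simp only [Set.mem_Icc] at h3
      refine ⟨T c - 1, by omega, ?_⟩
      have h4 := hg (T c - 1) (by omega)
      exact hb.injOn h4.1 h1 (by omega)
  have hlow : ∀ k ≤ n, Low ((List.range k).map g).toFinset := by
    intro k hk r c r' c' hm hr hc
    rw [hmem k hk] at hm ⊢
    have h1 := low_YD μ r c r' c' hm.1 hr hc
    refine ⟨h1, ?_⟩
    by_cases e : ((r', c') : ℕ × ℕ) = (r, c)
    · rw [e]; exact hm.2
    · have := hs _ h1 _ hm.1 e hr hc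
      omega
  have hv : ∀ k ≤ n, Valid ∅ ((List.range k).map g) := by
    intro k
    induction k with
    | zero => intro _; exact low_empty
    | succ k ih =>
      intro hk
      rw [List.range_succ, List.map_append, valid_append]
      refine ⟨ih (by omega), ?_⟩
      have l1 := hlow k (by omega)
      have l2 := hlow (k+1) hk
      refine ⟨by simpa using l1, ?_, ?_⟩
      · rw [Finset.union_empty, hmem k (by omega)]
        have := hg k (by omega)
        omega
      · rw [List.range_succ, List.map_append, List.toFinset_append] at l2
        have e : insert (g k) (((List.range k).map g).toFinset ∪ ∅) =
            ((List.range k).map g).toFinset ∪ ([k].map g).toFinset := by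
          ext; simp [or_comm]
        rw [e]; exact l2
  refine ⟨(List.range n).map g, hv n le_rfl, ?_, by simp, ?_⟩
  · ext c
    rw [hmem n le_rfl]
    constructor
    · exact fun h => h.1
    · intro h
      exact ⟨h, (hb.mapsTo h).2⟩
  · funext c
    by_cases hc : c ∈ μ.cells
    · have h3 := hb.mapsTo hc
      simp only [Set.mem_Icc] at h3
      have : tabOf ((List.range n).map g) c = (T c - 1) + 1 := by
        rw [tabOf_eq_iff (hv n le_rfl).nodup.1]
        simp only [List.getElem?_map]
        rw [List.getElem?_range (by omega)]
        have h4 := hg (T c - 1) (by omega)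
        simp only [Option.map_some, Option.some.injEq]
        exact hb.injOn h4.1 hc (by omega)
      rw [this]; omega
    · rw [h0 c hc]
      have : c ∉ ((List.range n).map g) := by
        rw [← List.mem_toFinset, hmem n le_rfl]; tauto
      simp only [tabOf, if_neg this]

theorem valid_idx_le {l : List (ℕ × ℕ)} (hv : Valid ∅ l) {c d : ℕ × ℕ} (hd : d ∈ l)
    (h1 : c.1 ≤ d.1) (h2 : c.2 ≤ d.2) : l.idxOf c ≤ l.idxOf d := by
  have hlt := List.idxOf_lt_length_iff.2 hd
  have e := List.take_append_drop (l.idxOf d + 1) l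
  have hv' := hv
  rw [← e, valid_append] at hv'
  have hL := hv'.1.low_toFinset
  have hdm : d ∈ (l.take (l.idxOf d + 1)).toFinset := by
    rw [List.mem_toFinset, List.mem_take_iff_getElem]
    exact ⟨l.idxOf d, by omega, by simp⟩
  have hcm := hL d.1 d.2 c.1 c.2 hdm h1 h2
  rw [List.mem_toFinset, List.mem_take_iff_getElem] at hcm
  obtain ⟨i, hi, hic⟩ := hcm
  have : l.idxOf c = i := by
    have hi' : i < l.length := by omega
    have : c = l[i] := hic.symm
    rw [this, hv.nodup.1.idxOf_getElem]
  omega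

theorem tabOf_standard {l : List (ℕ × ℕ)} (hv : Valid ∅ l) (μ : YoungDiagram)
    (hμ : μ.cells = l.toFinset) : IsStandard μ (tabOf l) := by
  have hnd := hv.nodup.1
  have hcard : μ.cells.card = l.length := by rw [hμ, List.toFinset_card_of_nodup hnd]
  have hmem : ∀ c, c ∈ μ.cells ↔ c ∈ l := by intro c; rw [hμ, List.mem_toFinset]
  refine ⟨⟨?_, ?_, ?_, ?_⟩, ?_⟩
  · intro c hc
    rw [hmem] at hc
    simp [tabOf, hc]
  · intro c hc
    have hc : c ∈ l := (hmem c).1 hc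
    have := List.idxOf_lt_length_iff.2 hc
    simp only [tabOf, if_pos hc, Set.mem_Icc]
    omega
  · intro c hc d hd h
    have hc : c ∈ l := (hmem c).1 hc
    have hd : d ∈ l := (hmem d).1 hd
    simp only [tabOf, if_pos hc, if_pos hd, Nat.add_right_cancel_iff] at h
    exact (List.idxOf_inj hc).1 h
  · rintro i ⟨h1, h2⟩
    have hi : i - 1 < l.length := by omega
    refine ⟨l[i-1], (hmem _).2 (List.getElem_mem _), ?_⟩
    have := (tabOf_eq_iff hnd l[i-1] (i-1)).2 (List.getElem?_eq_getElem hi)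
    omega
  · intro c hc d hd hne h1 h2
    rw [hmem] at hc hd
    have := valid_idx_le hv hd h1 h2
    have h3 : l.idxOf c ≠ l.idxOf d := fun e => hne ((List.idxOf_inj hc).1 e)
    simp only [tabOf, if_pos hc, if_pos hd]
    omega

def isD (l : List (ℕ × ℕ)) (i : ℕ) : Prop :=
  ∃ a b, l[i]? = some a ∧ l[i+1]? = some b ∧ a.1 < b.1

theorem isD_iff_dl (l i) : isD l i ↔ ∃ p, (dl l)[i]? = some p ∧ p := by
  induction l generalizing i with
  | nil => simp [isD, dl]
  | cons a l ih =>
    cases l with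
    | nil => simp [isD, dl]
    | cons b l =>
      cases i with
      | zero =>
        simp [isD, dl]
        exact ⟨fun h => ⟨_, Iff.rfl, h⟩, fun ⟨p, h1, h2⟩ => h1.2 h2⟩
      | succ i =>
        have := ih i
        simp only [isD, dl, List.getElem?_cons_succ] at this ⊢
        exact this

theorem dl_length (l) : (dl l).length = l.length - 1 := by
  induction l with
  | nil => rfl
  | cons a l ih =>
    cases l with
    | nil => rfl
    | cons b l => simp only [dl, List.length_cons] at ih ⊢; omega

theorem mem_DsiSet_tabOf {l : List (ℕ × ℕ)} (hn : l.Nodup) {n : ℕ} (hl : l.length = n) (i : ℕ) :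
    i ∈ DsiSet n (tabOf l) ↔ 1 ≤ i ∧ isD l (i - 1) := by
  simp only [DsiSet, Finset.mem_filter, Finset.mem_Ioo]
  constructor
  · rintro ⟨⟨h1, h2⟩, h3⟩
    refine ⟨h1, l[i-1], l[i], List.getElem?_eq_getElem _, ?_, ?_⟩
    · rw [Nat.sub_add_cancel h1]; exact List.getElem?_eq_getElem _
    · have e1 := rowIdx_tabOf hn (i-1) l[i-1] (List.getElem?_eq_getElem _)
      have e2 := rowIdx_tabOf hn i l[i] (List.getElem?_eq_getElem _)
      rw [Nat.sub_add_cancel h1] at e1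
      omega
  · rintro ⟨h1, a, b, ha, hb, hab⟩
    rw [Nat.sub_add_cancel h1] at hb
    have := (List.getElem?_eq_some_iff.1 hb).1
    refine ⟨⟨h1, by omega⟩, ?_⟩
    have e1 := rowIdx_tabOf hn (i-1) a ha
    have e2 := rowIdx_tabOf hn i b hb
    rw [Nat.sub_add_cancel h1] at e1
    omega

theorem Dsic_eq {s : List (ℕ × ℕ)} (hv : Valid ∅ s) {n : ℕ} (hl : s.length = n) :
    Dsic n (tabOf s) = DsiSet n (tabOf (evW n s)) := by
  have hv' := evW_valid n s hl hv
  have hl' := evW_length n s hl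
  have key : ∀ i, i ∈ DsiSet n (tabOf (evW n s)) ↔ 1 ≤ i ∧ i < n ∧ n - i ∈ DsiSet n (tabOf s) := by
    intro i
    rw [mem_DsiSet_tabOf hv'.nodup.1 hl', mem_DsiSet_tabOf hv.nodup.1 hl, isD_iff_dl, isD_iff_dl,
      evW_dl n s hl hv]
    have hdl := dl_length s
    by_cases hi : 1 ≤ i ∧ i < n
    · rw [List.getElem?_reverse (by omega)]
      have : (dl s).length - 1 - (i - 1) = n - i - 1 := by omega
      rw [this]
      constructor
      · rintro ⟨_, h⟩; exact ⟨hi.1, hi.2, by omega, h⟩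
      · rintro ⟨_, _, _, h⟩; exact ⟨hi.1, h⟩
    · constructor
      · rintro ⟨h1, p, h2, _⟩
        have := (List.getElem?_eq_some_iff.1 h2).1
        rw [List.length_reverse] at this
        omega
      · rintro ⟨h1, h2, _⟩; omega
  ext i
  rw [key, Dsic, Finset.mem_image]
  constructor
  · rintro ⟨j, hj, rfl⟩
    have : 0 < j ∧ j < n := by
      have := (Finset.mem_filter.1 hj).1
      simpa using this
    refine ⟨by omega, by omega, ?_⟩
    rwa [Nat.sub_sub_self (by omega)]
  · rintro ⟨h1, h2, h3⟩
    exact ⟨n - i, h3, by omega⟩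

/-! ### Part D: Robinson–Schensted on lists -/

def dom : List ℕ → List ℕ → Prop
  | _, [] => True
  | [], _ :: _ => False
  | a :: r, b :: s => a < b ∧ dom r s

@[simp] theorem dom_nil (r) : dom r [] := by cases r <;> trivial

theorem dom_iff (r s) : dom r s ↔ s.length ≤ r.length ∧ ∀ i < s.length, r.getD i 0 < s.getD i 0 := by
  induction r generalizing s with
  | nil => cases s <;> simp [dom]
  | cons a r ih =>
    cases s with
    | nil => simp [dom]
    | cons b s =>
      simp only [dom, ih, List.length_cons]
      constructor
      · rintro ⟨h1, h2, h3⟩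
        refine ⟨by omega, ?_⟩
        intro i hi
        cases i with
        | zero => simpa using h1
        | succ i => simpa using h3 i (by omega)
      · rintro ⟨h1, h2⟩
        refine ⟨by simpa using h2 0 (by omega), by omega, ?_⟩
        intro i hi
        simpa using h2 (i+1) (by omega)

def TV : List (List ℕ) → Prop
  | [] => True
  | r :: rs => r ≠ [] ∧ r.Pairwise (· < ·) ∧ dom r (rs.headD []) ∧ TV rs

theorem ri_perm (x r) : (∀ r', rowInsert x r = (r', none) → r' = r ++ [x]) ∧
    (∀ r' y, rowInsert x r = (r', some y) → (x :: r).Perm (y :: r')) := by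
  induction r with
  | nil => simp [rowInsert]
  | cons a r ih =>
    simp only [rowInsert]
    split
    · constructor
      · simp
      · rintro r' y h
        simp only [Prod.mk.injEq, Option.some.injEq] at h
        obtain ⟨rfl, rfl⟩ := h
        exact List.Perm.swap _ _ _
    · constructor
      · intro r' h
        simp only [Prod.mk.injEq] at h
        obtain ⟨rfl, h⟩ := h
        rw [ih.1 (rowInsert x r).1 (Prod.ext rfl h)]; rfl
      · intro r' y h
        simp only [Prod.mk.injEq] at h
        obtain ⟨rfl, h⟩ := h
        have := ih.2 (rowInsert x r).1 y (Prod.ext rfl h)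
        exact (List.Perm.swap _ _ _).trans ((this.cons a).trans (List.Perm.swap _ _ _))

theorem ri_none {x r r'} (h : rowInsert x r = (r', none)) : r' = r ++ [x] := (ri_perm x r).1 _ h
theorem ri_some {x r r' y} (h : rowInsert x r = (r', some y)) : (x :: r).Perm (y :: r') :=
  (ri_perm x r).2 _ _ h

theorem ri_none_lt {x r r'} (hx : x ∉ r) (h : rowInsert x r = (r', none)) : ∀ z ∈ r, z < x := by
  induction r generalizing r' with
  | nil => simp
  | cons a r ih =>
    simp only [rowInsert] at h
    split at h
    · simp at h
    · simp only [Prod.mk.injEq] at h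
      simp only [List.mem_cons, not_or] at hx
      intro z hz
      rcases List.mem_cons.1 hz with rfl | hz
      · omega
      · exact ih hx.2 (Prod.ext rfl h.2) z hz

theorem ri_of_lt {x r} (h : ∀ z ∈ r, z < x) : rowInsert x r = (r ++ [x], none) := by
  induction r with
  | nil => rfl
  | cons a r ih =>
    have h1 := h a (by simp)
    have h2 := ih (fun z hz => h z (by simp [hz]))
    simp only [rowInsert, h2, if_neg (not_lt.2 h1.le)]
    rfl

theorem ri_some_spec {x r r' y} (hx : x ∉ r) (hs : r.Pairwise (· < ·))
    (h : rowInsert x r = (r', some y)) :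
    y ∈ r ∧ x < y ∧ (∀ z ∈ r, z < y → z < x) ∧ r'.Pairwise (· < ·) := by
  induction r generalizing r' with
  | nil => simp [rowInsert] at h
  | cons a r ih =>
    simp only [List.mem_cons, not_or] at hx
    rw [List.pairwise_cons] at hs
    simp only [rowInsert] at h
    split at h
    · rename_i hxa
      simp only [Prod.mk.injEq, Option.some.injEq] at h
      obtain ⟨rfl, rfl⟩ := h
      refine ⟨by simp, hxa, ?_, ?_⟩
      · intro z hz hz'
        rcases List.mem_cons.1 hz with rfl | hz
        · omega
        · have := hs.1 z hz; omega
      · rw [List.pairwise_cons]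
        exact ⟨fun z hz => by have := hs.1 z hz; omega, hs.2⟩
    · simp only [Prod.mk.injEq] at h
      obtain ⟨rfl, h⟩ := h
      have hh : rowInsert x r = ((rowInsert x r).1, some y) := Prod.ext rfl h
      obtain ⟨h1, h2, h3, h4⟩ := ih hx.2 hs.2 hh
      refine ⟨by simp [h1], h2, ?_, ?_⟩
      · intro z hz hz'
        rcases List.mem_cons.1 hz with rfl | hz
        · omega
        · exact h3 z hz hz'
      · rw [List.pairwise_cons]
        refine ⟨fun z hz => ?_, h4⟩
        have : z ∈ x :: r := (ri_some hh).mem_iff.2 (by simp [hz])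
        rcases List.mem_cons.1 this with rfl | hz
        · omega
        · exact hs.1 z hz

theorem dom_mono {x r r' y s} (h : rowInsert x r = (r', some y)) (hd : dom r s) : dom r' s := by
  induction r generalizing r' s with
  | nil => simp [rowInsert] at h
  | cons a r ih =>
    cases s with
    | nil => simp
    | cons b s =>
      simp only [rowInsert] at h
      split at h
      · simp only [Prod.mk.injEq, Option.some.injEq] at h
        obtain ⟨rfl, rfl⟩ := h
        exact ⟨by have := hd.1; omega, hd.2⟩
      · simp only [Prod.mk.injEq] at h
        obtain ⟨rfl, h⟩ := h
        exact ⟨hd.1, ih (Prod.ext rfl h) hd.2⟩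

theorem dom_bump {x r r' y s} (hx : x ∉ r) (hs : r.Pairwise (· < ·))
    (h : rowInsert x r = (r', some y)) (hd : dom r s) : dom r' (rowInsert y s).1 := by
  induction r generalizing r' s with
  | nil => simp [rowInsert] at h
  | cons a r ih =>
    have spec := ri_some_spec hx hs h
    simp only [List.mem_cons, not_or] at hx
    rw [List.pairwise_cons] at hs
    simp only [rowInsert] at h
    split at h
    · rename_i hxa
      simp only [Prod.mk.injEq, Option.some.injEq] at h
      obtain ⟨rfl, rfl⟩ := h
      cases s with
      | nil => exact ⟨hxa, by simp⟩
      | cons b s =>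
        have := hd.1
        simp only [rowInsert, if_pos this]
        exact ⟨hxa, hd.2⟩
    · simp only [Prod.mk.injEq] at h
      obtain ⟨rfl, h⟩ := h
      have hh : rowInsert x r = ((rowInsert x r).1, some y) := Prod.ext rfl h
      have hay : a < y := by have := spec.2.1; omega
      cases s with
      | nil => exact ⟨hay, by simp⟩
      | cons b s =>
        simp only [rowInsert]
        split
        · exact ⟨hay, dom_mono hh hd.2⟩
        · exact ⟨hd.1, ih hx.2 hs.2 hh hd.2⟩

theorem dom_append {r s} (x : List ℕ) (h : dom r s) : dom (r ++ x) s := by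
  induction r generalizing s with
  | nil => cases s with
    | nil => simp
    | cons => exact h.elim
  | cons a r ih => cases s with
    | nil => simp
    | cons b s => exact ⟨h.1, ih h.2⟩

theorem headD_tabInsert (t y) : (tabInsert t y).headD [] = (rowInsert y (t.headD [])).1 := by
  cases t with
  | nil => rfl
  | cons r rs =>
    simp only [tabInsert, List.headD_cons]
    rcases h : rowInsert y r with ⟨r', _ | z⟩ <;> rfl

theorem tabInsert_perm (t x) : (tabInsert t x).flatten.Perm (x :: t.flatten) := by
  induction t generalizing x with
  | nil => simp [tabInsert]
  | cons r rs ih =>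
    simp only [tabInsert]
    rcases h : rowInsert x r with ⟨r', _ | z⟩
    · simp only [List.flatten_cons, ri_none h]
      simpa using List.perm_middle
    · simp only [List.flatten_cons]
      have h1 := ri_some h
      refine ((ih z).append_left r').trans ?_
      refine List.perm_middle.trans ?_
      exact (h1.symm.append_right rs.flatten)

theorem TV_insert (t x) (ht : TV t) (hn : (x :: t.flatten).Nodup) : TV (tabInsert t x) := by
  induction t generalizing x with
  | nil => simp [tabInsert, TV]
  | cons r rs ih =>
    obtain ⟨h1, h2, h3, h4⟩ := ht
    have hx : x ∉ r := by simp at hn; exact hn.1.1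
    simp only [tabInsert]
    rcases h : rowInsert x r with ⟨r', _ | z⟩
    · have := ri_none_lt hx h
      simp only [ri_none h]
      refine ⟨by simp, ?_, dom_append _ h3, h4⟩
      rw [List.pairwise_append]
      exact ⟨h2, by simp, by simpa using this⟩
    · have sp := ri_some_spec hx h2 h
      refine ⟨?_, sp.2.2.2, ?_, ?_⟩
      · rintro rfl
        have := (ri_some h).length_eq
        simp at this; exact h1 this
      · rw [headD_tabInsert]; exact dom_bump hx h2 h h3
      · apply ih _ h4
        simp only [List.flatten_cons, List.nodup_cons, List.nodup_append] at hn ⊢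
        exact ⟨fun hz => hn.2.2.2 z sp.1 z hz rfl, hn.2.2.1⟩

def len (t : List (List ℕ)) (i : ℕ) : ℕ := (t.getD i []).length

def newRow : List (List ℕ) → ℕ → ℕ
  | [], _ => 0
  | r :: rs, x =>
    match rowInsert x r with
    | (_, none) => 0
    | (_, some y) => newRow rs y + 1

theorem len_insert (t x i) : len (tabInsert t x) i = len t i + if i = newRow t x then 1 else 0 := by
  induction t generalizing x i with
  | nil => cases i <;> simp [tabInsert, len, newRow]
  | cons r rs ih =>
    rcases h : rowInsert x r with ⟨r', _ | z⟩ <;> simp only [tabInsert, newRow, h]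
    · cases i <;> simp [len, ri_none h]
    · cases i with
      | zero =>
        have := (ri_some h).length_eq
        simp at this
        simp [len, this]
      | succ i =>
        have := ih z i
        simp only [len] at this
        simpa [len] using this

theorem len_anti {t} (ht : TV t) : ∀ i j, i ≤ j → len t j ≤ len t i := by
  have key : ∀ t, TV t → ∀ i, len t (i+1) ≤ len t i := by
    intro t
    induction t with
    | nil => simp [len]
    | cons r rs ih =>
      intro h i
      cases i with
      | zero =>
        have := ((dom_iff _ _).1 h.2.2.1).1
        cases rs <;> simp [len] at this ⊢
        exact this
      | succ i => simpa [len] using ih h.2.2.2 i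
  intro i j hij
  exact antitone_nat_of_succ_le (key t ht) hij

theorem bump_rows (t x y) (ht : TV t) (hn : (x :: y :: t.flatten).Nodup) :
    newRow t x < newRow (tabInsert t x) y ↔ y < x := by
  induction t generalizing x y with
  | nil =>
    by_cases hyx : y < x <;> simp [newRow, tabInsert, rowInsert, hyx]
  | cons r rs ih =>
    obtain ⟨h1, h2, h3, h4⟩ := ht
    have hT := TV_insert (r :: rs) x ⟨h1, h2, h3, h4⟩ (by simp at hn ⊢; tauto)
    simp only [List.flatten_cons, List.nodup_cons, List.mem_cons, List.mem_append, not_or,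
      List.nodup_append] at hn
    obtain ⟨⟨hxy, hxr, hxrs⟩, ⟨hyr, hyrs⟩, hn1, hn2, hn3⟩ := hn
    rcases h : rowInsert x r with ⟨r', _ | z⟩
    · have hlt := ri_none_lt hxr h
      simp only [tabInsert, newRow, h]  at hT ⊢
      have hr' := ri_none h
      subst hr'
      rcases h' : rowInsert y (r ++ [x]) with ⟨r'', _ | z⟩
      · have := ri_none_lt (by simp [hyr, Ne.symm hxy]) h' x (by simp)
        simp; omega
      · have sp := ri_some_spec (by simp [hyr, Ne.symm hxy]) hT.2.1 h'
        simp only [Nat.zero_lt_succ, true_iff]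
        have h5 := sp.2.1
        rcases List.mem_append.1 sp.1 with h6 | h6
        · have := hlt z h6; omega
        · simp at h6; omega
    · simp only [tabInsert, newRow, h]  at hT ⊢
      have sp := ri_some_spec hxr h2 h
      have hp := ri_some h
      have hmem : ∀ u, u ∈ r' ↔ u = x ∨ (u ∈ r ∧ u ≠ z) := by
        intro u
        have h5 : (z :: r').Nodup := hp.nodup_iff.1 (by simp [hxr, hn1])
        have h6 := hp.mem_iff (a := u)
        simp only [List.mem_cons] at h6
        simp only [List.nodup_cons] at h5
        have h7 : z ≠ x := fun e => hxr (e ▸ sp.1)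
        constructor
        · intro hu
          have : u ≠ z := by rintro rfl; exact h5.1 hu
          tauto
        · rintro (rfl | ⟨h8, h9⟩)
          · have := h6.1 (Or.inl rfl)
            tauto
          · tauto
      have hyr' : y ∉ r' := by
        rw [hmem]; tauto
      rcases h' : rowInsert y r' with ⟨r'', _ | z'⟩
      · have := ri_none_lt hyr' h' x ((hmem x).2 (Or.inl rfl))
        simp; omega
      · have sp' := ri_some_spec hyr' hT.2.1 h'
        have hz' := (hmem z').1 sp'.1
        have hzz : z ≠ z' := by
          rintro rfl
          rcases hz' with e | e
          · exact hxr (e ▸ sp.1)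
          · exact e.2 rfl
        have hz'rs : z' ∉ rs.flatten := by
          rcases hz' with e | e
          · rw [e]; exact hxrs
          · intro hh; exact hn3 z' e.1 z' hh rfl
        simp only [Nat.add_lt_add_iff_right]
        rw [ih z z' h4 ?_]
        · constructor
          · intro hlt
            by_contra hc
            have hxy' : x < y := by omega
            have : z' ∈ r := by
              rcases hz' with e | e
              · have := sp'.2.1; omega
              · exact e.1
            have := sp.2.2.1 z' this hlt
            have := sp'.2.1
            omega
          · intro hlt
            have := sp.2.1
            have h8 := sp'.2.2.1 x ((hmem x).2 (Or.inl rfl))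
            by_contra hc
            have := h8 (by omega)
            omega
        · simp only [List.nodup_cons, List.mem_cons, not_or]
          exact ⟨⟨hzz, fun hh => hn3 z sp.1 z hh rfl⟩, hz'rs, hn2⟩

/-! reverse bumping -/

theorem revbump (r s' y) (hr : r.Pairwise (· < ·)) (hs : s'.Pairwise (· < ·)) (hy : y ∉ r)
    (hd : dom r (rowInsert y s').1) :
    ∃ r' x, rowInsert x r' = (r, some y) ∧ r'.Pairwise (· < ·) ∧ dom r' s' ∧ r' ≠ [] := by
  induction r generalizing s' with
  | nil =>
    cases s' with
    | nil => exact hd.elim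
    | cons b s =>
      simp only [rowInsert] at hd
      split at hd <;> exact hd.elim
  | cons a r ih =>
    simp only [List.mem_cons, not_or] at hy
    rw [List.pairwise_cons] at hr
    -- the recursive step
    have hstep : ∀ s'', s''.Pairwise (· < ·) → dom r (rowInsert y s'').1 → a < y →
        dom (a :: r) (s'.take 1) → (∀ q, dom q s'' → dom q s'.tail) →
        ∃ r' x, rowInsert x r' = (a :: r, some y) ∧ r'.Pairwise (· < ·) ∧ dom r' s' ∧ r' ≠ [] := by
      intro s'' hs'' hd'' hay hda hq
      obtain ⟨r', x, e1, e2, e3, e4⟩ := ih s'' hr.2 hs'' hy.2 hd''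
      have hp := ri_some e1
      have hax : a < x := by
        have hh : x ∈ y :: r := hp.mem_iff.1 (by simp)
        rcases List.mem_cons.1 hh with h | h
        · omega
        · exact hr.1 x h
      refine ⟨a :: r', x, ?_, ?_, ?_, by simp⟩
      · simp [rowInsert, not_lt.2 hax.le, e1]
      · rw [List.pairwise_cons]
        refine ⟨fun z hz => ?_, e2⟩
        have hh : z ∈ y :: r := hp.mem_iff.1 (by simp [hz])
        rcases List.mem_cons.1 hh with h | h
        · omega
        · exact hr.1 z h
      · cases s' with
        | nil => simp
        | cons b s =>
          exact ⟨hda.1, hq _ e3⟩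
    have hfin : a < y → (∀ z ∈ r, y < z) → (∀ z ∈ s'.take 1, y < z) → dom r s'.tail → 
        ∃ r' x, rowInsert x r' = (a :: r, some y) ∧ r'.Pairwise (· < ·) ∧ dom r' s' ∧ r' ≠ [] := by
      intro hay hyr hys hdt
      refine ⟨y :: r, a, by simp [rowInsert, hay], ?_, ?_, by simp⟩
      · rw [List.pairwise_cons]; exact ⟨hyr, hr.2⟩
      · cases s' with
        | nil => simp
        | cons b s => exact ⟨hys b (by simp), hdt⟩
    have split_r : (∃ b r1, r = b :: r1 ∧ b < y) ∨ ∀ z ∈ r, y < z := by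
      cases r with
      | nil => right; simp
      | cons b r1 =>
        by_cases h : b < y
        · exact Or.inl ⟨b, r1, rfl, h⟩
        · right
          simp only [List.mem_cons, not_or] at hy
          have h2 := hr.2
          rw [List.pairwise_cons] at h2
          intro z hz
          rcases List.mem_cons.1 hz with rfl | hz
          · omega
          · have := h2.1 z hz; omega
    cases s' with
    | nil =>
      have hay : a < y := hd.1
      rcases split_r with ⟨b, r1, rfl, hb⟩ | h
      · exact hstep [] (by simp) ⟨hb, by simp⟩ hay (by simp) (by simp)
      · exact hfin hay h (by simp) (by simp)
    | cons b s =>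
      rw [List.pairwise_cons] at hs
      simp only [rowInsert] at hd
      split at hd
      · rename_i hyb
        have hay : a < y := hd.1
        rcases split_r with ⟨c, r1, rfl, hb⟩ | h
        · refine hstep s hs.2 ?_ hay ⟨by omega, by simp⟩ (fun q hq => hq)
          cases s with
          | nil => exact ⟨hb, by simp⟩
          | cons d s =>
            have := hs.1 d (by simp)
            simp only [rowInsert, if_pos (show y < d by omega)]
            exact ⟨hb, hd.2.2⟩
        · exact hfin hay h (by simpa using hyb) hd.2
      · have hab := hd.1
        exact hstep s hs.2 hd.2 (by omega) ⟨hab, by simp⟩ (fun q hq => hq)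

theorem dom_init {r s x} (h : dom (r ++ [x]) s) (hl : s.length ≤ r.length) : dom r s := by
  rw [dom_iff] at h ⊢
  refine ⟨hl, fun i hi => ?_⟩
  have := h.2 i hi
  rwa [List.getD_append _ _ _ _ (by omega)] at this

theorem TV_headD_nil {t} (ht : TV t) (h : t.headD [] = []) : t = [] := by
  cases t with
  | nil => rfl
  | cons r rs => exact absurd h ht.1

theorem rev_insert (t i) (ht : TV t) (hn : t.flatten.Nodup) (hi : len t (i + 1) < len t i) :
    ∃ t' x, tabInsert t' x = t ∧ TV t' ∧ newRow t' x = i := by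
  induction t generalizing i with
  | nil => simp [len] at hi
  | cons r rs ih =>
    obtain ⟨h1, h2, h3, h4⟩ := ht
    cases i with
    | zero =>
      obtain ⟨r0, x, rfl⟩ : ∃ r0 x, r = r0 ++ [x] := by
        rcases List.eq_nil_or_concat r with e | ⟨a, b, e⟩
        · exact absurd e h1
        · exact ⟨a, b, by simpa using e⟩
      have hl : (rs.headD []).length ≤ r0.length := by
        cases rs <;> simp [len] at hi ⊢
        omega
      rw [List.pairwise_append] at h2
      have hri := ri_of_lt (x := x) (r := r0) (fun z hz => h2.2.2 z hz x (by simp))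
      by_cases e : r0 = []
      · subst e
        have : rs = [] := TV_headD_nil h4 (by simpa using hl)
        subst this
        exact ⟨[], x, rfl, trivial, rfl⟩
      · refine ⟨r0 :: rs, x, by simp [tabInsert, hri], ⟨e, h2.1, dom_init h3 hl, h4⟩, by simp [newRow, hri]⟩
    | succ i =>
      simp only [List.flatten_cons, List.nodup_append] at hn
      obtain ⟨t', y, e1, e2, e3⟩ := ih i h4 hn.2.1 (by simpa [len] using hi)
      have hy : y ∉ r := by
        intro hh
        refine hn.2.2 y hh y ?_ rfl
        rw [← e1]
        exact (tabInsert_perm t' y).mem_iff.2 (by simp)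
      have hs : (t'.headD []).Pairwise (· < ·) := by
        cases t' with
        | nil => simp
        | cons a b => exact e2.2.1
      rw [← e1, headD_tabInsert] at h3
      obtain ⟨r', x, f1, f2, f3, f4⟩ := revbump r _ y h2 hs hy h3
      exact ⟨r' :: t', x, by simp [tabInsert, f1, e1], ⟨f4, f2, f3, e2⟩, by simp [newRow, f1, e3]⟩

/-! ### Part E: recording words -/

def qAux : List (List ℕ) → List ℕ → List (ℕ × ℕ)
  | _, [] => []
  | t, x :: u => (newRow t x, len t (newRow t x)) :: qAux (tabInsert t x) u

theorem qAux_length (t u) : (qAux t u).length = u.length := by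
  induction u generalizing t with
  | nil => rfl
  | cons x u ih => simp [qAux, ih]

theorem qAux_append (t) (u v : List ℕ) :
    qAux t (u ++ v) = qAux t u ++ qAux (u.foldl tabInsert t) v := by
  induction u generalizing t with
  | nil => rfl
  | cons x u ih => simp [qAux, ih]

theorem fold_perm (t : List (List ℕ)) (u : List ℕ) : (u.foldl tabInsert t).flatten.Perm (u ++ t.flatten) := by
  induction u generalizing t with
  | nil => simp
  | cons x u ih =>
    simp only [List.foldl_cons]
    refine (ih _).trans ?_
    refine ((tabInsert_perm t x).append_left u).trans ?_
    exact List.perm_middle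

theorem nodup_step {t x u} (hn : ((x :: u) ++ t.flatten).Nodup) :
    (x :: t.flatten).Nodup ∧ (u ++ (tabInsert t x).flatten).Nodup := by
  constructor
  · refine hn.sublist ?_
    simp
  · refine List.Perm.nodup ?_ hn
    exact (List.perm_middle.symm).trans ((tabInsert_perm t x).symm.append_left u)

theorem fold_TV (t : List (List ℕ)) (u : List ℕ) (ht : TV t) (hn : (u ++ t.flatten).Nodup) : TV (u.foldl tabInsert t) := by
  induction u generalizing t with
  | nil => exact ht
  | cons x u ih =>
    obtain ⟨h1, h2⟩ := nodup_step hn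
    exact ih _ (TV_insert t x ht h1) h2

theorem inSh_insert (t x) (c : ℕ × ℕ) : c.2 < len (tabInsert t x) c.1 ↔
    c = (newRow t x, len t (newRow t x)) ∨ c.2 < len t c.1 := by
  rw [len_insert]
  obtain ⟨a, b⟩ := c
  simp only [Prod.mk.injEq]
  by_cases h : a = newRow t x
  · subst h; simp; omega
  · simp [h]

theorem inSh_fold (t : List (List ℕ)) (u : List ℕ) (c : ℕ × ℕ) : c.2 < len (u.foldl tabInsert t) c.1 ↔
    c ∈ qAux t u ∨ c.2 < len t c.1 := by
  induction u generalizing t with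
  | nil => simp [qAux]
  | cons x u ih =>
    simp only [List.foldl_cons, ih, inSh_insert, qAux, List.mem_cons]
    tauto

theorem low_of_TV {t} (ht : TV t) {S : Finset (ℕ × ℕ)} (hS : ∀ c, c ∈ S ↔ c.2 < len t c.1) :
    Low S := by
  intro r c r' c' h h1 h2
  rw [hS] at h ⊢
  have := len_anti ht r' r h1
  simp only at *
  omega

theorem qAux_valid (t u) (ht : TV t) (hn : (u ++ t.flatten).Nodup) (S : Finset (ℕ × ℕ))
    (hS : ∀ c, c ∈ S ↔ c.2 < len t c.1) : Valid S (qAux t u) := by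
  induction u generalizing t S with
  | nil => exact low_of_TV ht hS
  | cons x u ih =>
    obtain ⟨h1, h2⟩ := nodup_step hn
    refine ⟨low_of_TV ht hS, by simp [hS], ?_⟩
    apply ih _ (TV_insert t x ht h1) h2
    intro c
    rw [inSh_insert, Finset.mem_insert, hS]

theorem qAux_isD (t u) (ht : TV t) (hn : (u ++ t.flatten).Nodup) (i : ℕ) :
    isD (qAux t u) i ↔ ∃ a b, u[i]? = some a ∧ u[i+1]? = some b ∧ b < a := by
  induction u generalizing t i with
  | nil => simp [isD, qAux]
  | cons x u ih =>
    obtain ⟨h1, h2⟩ := nodup_step hn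
    cases i with
    | succ i =>
      have := ih _ (TV_insert t x ht h1) h2 i
      simpa [isD, qAux] using this
    | zero =>
      cases u with
      | nil => simp [isD, qAux]
      | cons y u =>
        have h3 : (x :: y :: t.flatten).Nodup := by
          refine hn.sublist ?_
          simp
        have := bump_rows t x y ht h3
        simpa [isD, qAux] using this

theorem rs_surj (q) (hq : Valid ∅ q) : ∀ t, TV t → t.flatten.Nodup →
    (∀ c, c ∈ q ↔ c.2 < len t c.1) → ∃ u, u.foldl tabInsert [] = t ∧ qAux [] u = q := by
  induction q using List.reverseRecOn with
  | nil =>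
    intro t ht _ h
    refine ⟨[], ?_, rfl⟩
    have := h (0, 0)
    simp [len] at this
    cases t with
    | nil => rfl
    | cons r rs => exact absurd (by simpa using this) ht.1
  | append_singleton q v ih =>
    intro t ht hn h
    have hv := valid_append.1 hq
    have hlow := hv.1.low_toFinset
    have hvq : v ∉ q := by
      have := hq.nodup.1
      rw [List.nodup_append] at this
      intro hh; exact this.2.2 v hh v (by simp) rfl
    have a1 : v.2 < len t v.1 := (h v).1 (by simp)
    have a2 : len t v.1 ≤ v.2 + 1 := by
      by_contra hc
      have := (h (v.1, v.2+1)).2 (by simp; omega)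
      have h3 : (v.1, v.2+1) ∈ q := by
        rcases List.mem_append.1 this with h | h
        · exact h
        · simp [Prod.ext_iff] at h
      exact hvq (by simpa using hlow v.1 (v.2+1) v.1 v.2 (by simpa using h3) le_rfl (by omega))
    have a3 : len t (v.1+1) ≤ v.2 := by
      by_contra hc
      have := (h (v.1+1, v.2)).2 (by simp; omega)
      have h3 : (v.1+1, v.2) ∈ q := by
        rcases List.mem_append.1 this with h | h
        · exact h
        · simp [Prod.ext_iff] at h
      exact hvq (by simpa using hlow (v.1+1) v.2 v.1 v.2 (by simpa using h3) (by omega) le_rfl)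
    obtain ⟨t', x, rfl, e2, e3⟩ := rev_insert t v.1 ht hn (by omega)
    have hl : len t' v.1 = v.2 := by
      have := len_insert t' x v.1
      simp [e3] at this
      omega
    have hn' := ((tabInsert_perm t' x).nodup_iff.1 hn)
    obtain ⟨u, f1, f2⟩ := ih hv.1 t' e2 (List.nodup_cons.1 hn').2 (by
      intro c
      have h1 := h c
      rw [inSh_insert, e3, hl] at h1
      simp only [List.mem_append, List.mem_singleton] at h1
      by_cases hc : c = v
      · subst hc
        simp [hvq, hl]
      · have : c ≠ (v.1, v.2) := hc
        tauto)
    refine ⟨u ++ [x], by simp [f1], ?_⟩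
    rw [qAux_append, f2, f1]
    simp [qAux, e3, hl]

/-! ### Part E2: the Robinson-Schensted correspondence for permutations -/

theorem listEntry_ne {t : List (List ℕ)} (h : ∀ x ∈ t.flatten, x ≠ 0) (c : ℕ × ℕ) :
    listEntry t c ≠ 0 ↔ c.2 < len t c.1 := by
  unfold listEntry len
  constructor
  · intro h1
    by_contra hc
    exact h1 (List.getD_eq_default _ _ (by omega))
  · intro h1
    rw [List.getD_eq_getElem _ _ h1]
    apply h
    rw [List.mem_flatten]
    refine ⟨t.getD c.1 [], ?_, List.getElem_mem _⟩
    by_cases h2 : c.1 < t.length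
    · rw [List.getD_eq_getElem _ _ h2]; exact List.getElem_mem _
    · rw [List.getD_eq_default _ _ (by omega)] at h1; simp at h1

theorem listEntry_mem {t : List (List ℕ)} (c : ℕ × ℕ) (h1 : c.2 < len t c.1) :
    listEntry t c ∈ t.flatten := by
  unfold listEntry
  unfold len at h1
  rw [List.getD_eq_getElem _ _ h1]
  rw [List.mem_flatten]
  refine ⟨t.getD c.1 [], ?_, List.getElem_mem _⟩
  by_cases h2 : c.1 < t.length
  · rw [List.getD_eq_getElem _ _ h2]; exact List.getElem_mem _
  · rw [List.getD_eq_default _ _ (by omega)] at h1; simp at h1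

theorem mem_listEntry {t : List (List ℕ)} {x} (h : x ∈ t.flatten) :
    ∃ c : ℕ × ℕ, c.2 < len t c.1 ∧ listEntry t c = x := by
  rw [List.mem_flatten] at h
  obtain ⟨r, hr, hx⟩ := h
  obtain ⟨i, hi, rfl⟩ := List.getElem_of_mem hr
  obtain ⟨j, hj, rfl⟩ := List.getElem_of_mem hx
  refine ⟨(i, j), ?_, ?_⟩
  · unfold len; simp only; rw [List.getD_eq_getElem _ _ hi]; exact hj
  · unfold listEntry; simp only; rw [List.getD_eq_getElem _ _ hi, List.getD_eq_getElem _ _ hj]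

theorem oneLine_getElem? (N w i) : (oneLine N w)[i]? = if i < N then some (w (i+1)) else none := by
  unfold oneLine
  rw [List.getElem?_map]
  split
  · rename_i h; simp [h]
  · rename_i h; simp [h]

theorem suppIn_mem {N w} (hw : SuppIn N w) {i} (h1 : 1 ≤ i) (h2 : i ≤ N) : 1 ≤ w i ∧ w i ≤ N := by
  constructor
  · by_contra hc
    have h0 : w i = 0 := by omega
    have := hw 0 (Or.inl rfl)
    have := w.injective (h0.trans this.symm)
    omega
  · by_contra hc
    have := hw (w i) (Or.inr (by omega))
    have := w.injective this
    omega

theorem mem_oneLine {N w} (hw : SuppIn N w) (x) : x ∈ oneLine N w ↔ 1 ≤ x ∧ x ≤ N := by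
  unfold oneLine
  simp only [List.mem_map, List.mem_range]
  constructor
  · rintro ⟨i, hi, rfl⟩
    exact suppIn_mem hw (by omega) (by omega)
  · intro ⟨h1, h2⟩
    have hne : ¬ (w.symm x = 0 ∨ N < w.symm x) := by
      intro h
      have := hw _ h
      rw [Equiv.apply_symm_apply] at this
      omega
    refine ⟨w.symm x - 1, by omega, ?_⟩
    rw [show w.symm x - 1 + 1 = w.symm x by omega]
    simp

theorem oneLine_nodup (N w) : (oneLine N w).Nodup := by
  unfold oneLine
  refine List.Nodup.map ?_ List.nodup_range
  intro a b h
  have := w.injective h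
  omega

theorem qAux_take (u : List ℕ) (m) : qAux [] (u.take m) = (qAux [] u).take m := by
  have h0 : qAux [] u = qAux [] (u.take m) ++ qAux ((u.take m).foldl tabInsert []) (u.drop m) := by
    rw [← qAux_append, List.take_append_drop]
  rw [h0]
  by_cases h : m ≤ u.length
  · have h1 : (qAux [] (u.take m)).length = m := by simp [qAux_length, h]
    rw [List.take_append_of_le_length (by omega)]
    exact (List.take_of_length_le (by omega)).symm
  · have h1 : u.drop m = [] := by simp; omega
    rw [h1]
    simp only [qAux, List.append_nil]
    exact (List.take_of_length_le (by rw [qAux_length]; simp)).symm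

theorem sInf_take {q : List (ℕ × ℕ)} (c) : sInf {m | c ∈ q.take m} = tabOf q c := by
  have hm : ∀ m, c ∈ q.take m ↔ c ∈ q ∧ q.idxOf c < m := by
    intro m
    constructor
    · intro h
      refine ⟨List.mem_of_mem_take h, ?_⟩
      obtain ⟨i, hi, rfl⟩ := List.getElem_of_mem h
      simp only [List.length_take] at hi
      rw [List.getElem_take]
      have : q.idxOf q[i] ≤ i := by
        by_contra hc
        have := List.not_of_lt_findIdx (p := (· == q[i])) (xs := q) (i := i) (by
          simpa [List.idxOf] using hc)
        simp at this
      omega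
    · rintro ⟨h1, h2⟩
      have h3 := List.idxOf_lt_length_of_mem h1
      have : c = (q.take m)[q.idxOf c]'(by simp; omega) := by
        rw [List.getElem_take]; simp
      rw [this]
      exact List.getElem_mem _
  simp only [hm, tabOf]
  split
  · rename_i h
    apply le_antisymm
    · apply Nat.sInf_le
      exact ⟨h, by omega⟩
    · apply le_csInf (show Set.Nonempty {m | c ∈ q ∧ q.idxOf c < m} from ⟨q.idxOf c + 1, h, by omega⟩)
      rintro b ⟨_, hb⟩
      omega
  · rename_i h
    simp [h]

theorem Qtab_eq {N w} (hw : SuppIn N w) : Qtab N w = tabOf (qAux [] (oneLine N w)) := by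
  funext c
  rw [← sInf_take]
  unfold Qtab
  congr 1
  ext m
  simp only [Set.mem_setOf_eq]
  rw [listEntry_ne]
  · unfold PtabListPart
    rw [inSh_fold, ← qAux_take]
    simp [len]
  · intro x hx
    have := (fold_perm [] ((oneLine N w).take m)).mem_iff.1 hx
    simp only [List.flatten_nil, List.append_nil] at this
    have := (mem_oneLine hw x).1 (List.mem_of_mem_take this)
    omega

theorem rs_forward {N w} (hw : SuppIn N w) : ∃ q, Valid ∅ q ∧ q.length = N ∧ Qtab N w = tabOf q ∧
    IsFillingF q.toFinset (Ptab N w) ∧ DslSet N w = DsiSet N (tabOf q) := by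
  have hnd := oneLine_nodup N w
  have hlen : (oneLine N w).length = N := by simp [oneLine]
  have hv : Valid ∅ (qAux [] (oneLine N w)) :=
    qAux_valid [] _ trivial (by simpa using hnd) ∅ (by simp [len])
  have hql : (qAux [] (oneLine N w)).length = N := by rw [qAux_length, hlen]
  refine ⟨qAux [] (oneLine N w), hv, hql, Qtab_eq hw, ?_, ?_⟩
  · have hcard : (qAux [] (oneLine N w)).toFinset.card = N := by
      rw [List.toFinset_card_of_nodup hv.nodup.1, hql]
    have hpt : PtabListPart N w N = (oneLine N w).foldl tabInsert [] := by
      unfold PtabListPart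
      rw [List.take_of_length_le (by omega)]
    have hmem : ∀ x, x ∈ (PtabListPart N w N).flatten ↔ 1 ≤ x ∧ x ≤ N := by
      intro x
      rw [hpt, (fold_perm [] (oneLine N w)).mem_iff]
      simpa using mem_oneLine hw x
    have hcell : ∀ c : ℕ × ℕ, c ∈ (qAux [] (oneLine N w)).toFinset ↔ c.2 < len (PtabListPart N w N) c.1 := by
      intro c
      rw [hpt, inSh_fold]
      simp [len]
    have hmaps : Set.MapsTo (Ptab N w) ↑(qAux [] (oneLine N w)).toFinset ↑(Finset.Icc 1 N) := by
      intro c hc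
      have := (hmem _).1 (listEntry_mem c ((hcell c).1 hc))
      simpa [Ptab] using this
    have hsurj : Set.SurjOn (Ptab N w) ↑(qAux [] (oneLine N w)).toFinset ↑(Finset.Icc 1 N) := by
      intro x hx
      obtain ⟨c, h1, h2⟩ := mem_listEntry ((hmem x).2 (by simpa using hx))
      exact ⟨c, (hcell c).2 h1, h2⟩
    constructor
    · intro c hc
      by_contra h
      refine hc ((hcell c).2 ((listEntry_ne ?_ c).1 h))
      intro x hx
      have := (hmem x).1 hx
      omega
    · rw [hcard]
      have hinj := Finset.injOn_of_surjOn_of_card_le (Ptab N w) hmaps hsurj (by simp [hcard])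
      rw [← Finset.coe_Icc]
      exact ⟨hmaps, hinj, hsurj⟩
  · ext i
    rw [mem_DsiSet_tabOf hv.nodup.1 hql, qAux_isD [] _ trivial (by simpa using hnd)]
    simp only [DslSet, Finset.mem_filter, Finset.mem_Ioo, oneLine_getElem?]
    constructor
    · rintro ⟨⟨h1, h2⟩, h3⟩
      refine ⟨h1, w i, w (i+1), ?_, ?_, h3⟩
      · rw [if_pos (by omega), show i - 1 + 1 = i by omega]
      · rw [if_pos (by omega), show i - 1 + 1 = i by omega]
    · rintro ⟨h1, a, b, h2, h3, h4⟩
      rw [show i - 1 + 1 = i by omega] at h2 h3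
      split at h3
      · split at h2
        · simp at h2 h3
          subst h2 h3
          exact ⟨⟨h1, by omega⟩, h4⟩
        · simp at h2
      · simp at h3

theorem TV_of (t : List (List ℕ)) (h : ∀ i < t.length, t.getD i [] ≠ [] ∧
    (t.getD i []).Pairwise (· < ·) ∧ dom (t.getD i []) (t.getD (i+1) [])) : TV t := by
  induction t with
  | nil => trivial
  | cons r rs ih =>
    have h0 := h 0 (by simp)
    refine ⟨by simpa using h0.1, by simpa using h0.2.1, ?_, ?_⟩
    · have := h0.2.2
      cases rs <;> simpa using this
    · apply ih
      intro i hi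
      simpa using h (i+1) (by simpa using hi)

theorem rs_backward {ν : YoungDiagram} {P : Tab} (hP : IsStandard ν P) {N} (hN : ν.cells.card = N)
    {q} (hq : Valid ∅ q) (hqν : q.toFinset = ν.cells) :
    ∃ w, SuppIn N w ∧ Ptab N w = P ∧ Qtab N w = tabOf q := by
  obtain ⟨⟨hout, hbij⟩, hinc⟩ := hP
  rw [hN] at hbij
  set t : List (List ℕ) := (List.range (ν.colLen 0)).map fun r =>
    (List.range (ν.rowLen r)).map fun c => P (r, c) with ht
  have hmemr : ∀ r c, (r, c) ∈ ν.cells ↔ c < ν.rowLen r := by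
    intro r c
    rw [YoungDiagram.mem_cells, YoungDiagram.mem_iff_lt_rowLen]
  have hcol : ∀ r c, (r, c) ∈ ν.cells → r < ν.colLen 0 := by
    intro r c h
    rw [← YoungDiagram.mem_iff_lt_colLen]
    exact ν.up_left_mem le_rfl (Nat.zero_le c) h
  have hrow : ∀ r, t.getD r [] = (List.range (ν.rowLen r)).map fun c => P (r, c) := by
    intro r
    by_cases hr : r < ν.colLen 0
    · rw [List.getD_eq_getElem _ _ (by simpa [ht] using hr)]
      simp [ht]
    · rw [List.getD_eq_default _ _ (by simp [ht]; omega)]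
      have : ν.rowLen r = 0 := by
        by_contra hc
        exact hr (hcol r 0 ((hmemr r 0).2 (by omega)))
      simp [this]
  have hlen : ∀ r, len t r = ν.rowLen r := by
    intro r; unfold len; rw [hrow]; simp
  have hent : ∀ c, listEntry t c = P c := by
    rintro ⟨r, c⟩
    unfold listEntry
    simp only [hrow]
    by_cases hc : c < ν.rowLen r
    · rw [List.getD_eq_getElem _ _ (by simpa using hc)]; simp
    · rw [List.getD_eq_default _ _ (by simp; omega), hout]
      rw [hmemr]; exact hc
  have hcell : ∀ c : ℕ × ℕ, c ∈ q ↔ c.2 < len t c.1 := by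
    intro c
    rw [hlen, ← hmemr, ← hqν]; simp
  have hTV : TV t := by
    apply TV_of
    intro r hr
    have hr' : r < ν.colLen 0 := by simpa [ht] using hr
    have hr0 : (r, 0) ∈ ν.cells := by
      rw [YoungDiagram.mem_cells, YoungDiagram.mem_iff_lt_colLen]; exact hr'
    refine ⟨?_, ?_, ?_⟩
    · rw [hrow]
      have := (hmemr r 0).1 hr0
      simp; omega
    · rw [hrow, List.pairwise_map]
      have h3 : (List.range (ν.rowLen r)).Pairwise (· < ·) := List.pairwise_lt_range
      refine List.Pairwise.imp_of_mem ?_ h3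
      intro a b ha hb hab
      simp only [List.mem_range] at ha hb
      exact hinc _ ((hmemr r a).2 ha) _ ((hmemr r b).2 hb) (by simp; omega) le_rfl hab.le
    · rw [dom_iff, hrow, hrow]
      have ha : ν.rowLen (r+1) ≤ ν.rowLen r := ν.rowLen_anti _ _ (Nat.le_succ r)
      refine ⟨by simpa using ha, ?_⟩
      intro i hi
      simp only [List.length_map, List.length_range] at hi
      rw [List.getD_eq_getElem _ _ (by simp; omega), List.getD_eq_getElem _ _ (by simpa using hi)]
      simp only [List.getElem_map, List.getElem_range]
      refine hinc _ ((hmemr _ _).2 (by omega)) _ ((hmemr _ _).2 hi) (by simp) (by simp) le_rfl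
  have hflat : ∀ x, x ∈ t.flatten ↔ 1 ≤ x ∧ x ≤ N := by
    intro x
    constructor
    · intro h
      obtain ⟨c, h1, rfl⟩ := mem_listEntry h
      rw [hent]
      exact hbij.mapsTo (by rw [hlen, ← hmemr] at h1; exact h1)
    · intro h
      obtain ⟨c, h1, rfl⟩ := hbij.surjOn (show x ∈ Set.Icc 1 N from h)
      rw [← hent]
      apply listEntry_mem
      rw [hlen, ← hmemr]; exact h1
  have hnd : t.flatten.Nodup := by
    rw [List.nodup_flatten]
    constructor
    · intro l hl
      simp only [ht, List.mem_map, List.mem_range] at hl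
      obtain ⟨r, hr, rfl⟩ := hl
      refine List.Nodup.map_on ?_ List.nodup_range
      intro a ha b hb hab
      simp only [List.mem_range] at ha hb
      have := hbij.injOn ((hmemr r a).2 ha) ((hmemr r b).2 hb) hab
      simpa using this
    · rw [ht, List.pairwise_map]
      have h3 : (List.range (ν.colLen 0)).Pairwise (· < ·) := List.pairwise_lt_range
      refine h3.imp ?_
      intro a b hab x hx hy
      simp only [List.mem_map, List.mem_range] at hx hy
      obtain ⟨i, hi, rfl⟩ := hx
      obtain ⟨j, hj, h⟩ := hy
      have := hbij.injOn ((hmemr b j).2 hj) ((hmemr a i).2 hi) h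
      simp at this
      omega
  obtain ⟨u, hu1, hu2⟩ := rs_surj q hq t hTV hnd hcell
  have hperm : t.flatten.Perm u := by
    have := fold_perm [] u
    rw [hu1] at this; simpa using this
  have hund : u.Nodup := hperm.nodup_iff.1 hnd
  have hum : ∀ x, x ∈ u ↔ 1 ≤ x ∧ x ≤ N := fun x => by rw [← hperm.mem_iff, hflat]
  have hul : u.length = N := by
    rw [← qAux_length [] u, hu2, ← List.toFinset_card_of_nodup hq.nodup.1, hqν, hN]
  set f : ℕ → ℕ := fun i => if h : 1 ≤ i ∧ i ≤ N then u[i-1]'(by omega) else i with hf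
  have hfin : ∀ i (h : 1 ≤ i ∧ i ≤ N), f i = u[i-1]'(by omega) := fun i h => by simp [hf, h]
  have hfout : ∀ i, ¬ (1 ≤ i ∧ i ≤ N) → f i = i := fun i h => by simp only [hf, dif_neg h]
  have hfm : ∀ i (h : 1 ≤ i ∧ i ≤ N), 1 ≤ f i ∧ f i ≤ N := by
    intro i h
    rw [← hum, hfin i h]; exact List.getElem_mem _
  have hfb : Function.Bijective f := by
    constructor
    · intro i j hij
      by_cases hi : 1 ≤ i ∧ i ≤ N <;> by_cases hj : 1 ≤ j ∧ j ≤ N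
      · rw [hfin i hi, hfin j hj] at hij
        have := (hund.getElem_inj_iff).1 hij
        omega
      · exfalso; apply hj; rw [← hfout j hj, ← hij]; exact hfm i hi
      · exfalso; apply hi; rw [← hfout i hi, hij]; exact hfm j hj
      · rwa [hfout i hi, hfout j hj] at hij
    · intro y
      by_cases hy : 1 ≤ y ∧ y ≤ N
      · obtain ⟨i, hi, rfl⟩ := List.getElem_of_mem ((hum y).2 hy)
        refine ⟨i+1, ?_⟩
        rw [hfin (i+1) (by omega)]
        rfl
      · exact ⟨y, hfout y hy⟩
  have hw : SuppIn N (Equiv.ofBijective f hfb) := by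
    intro i hi
    rw [Equiv.ofBijective_apply]
    exact hfout i (by omega)
  have hone : oneLine N (Equiv.ofBijective f hfb) = u := by
    apply List.ext_getElem
    · simp [oneLine, hul]
    · intro i h1 h2
      simp only [oneLine, List.getElem_map, List.getElem_range, Equiv.ofBijective_apply]
      rw [hfin (i+1) (by omega)]
      rfl
  refine ⟨Equiv.ofBijective f hfb, hw, ?_, ?_⟩
  · funext c
    unfold Ptab PtabListPart
    rw [hone, List.take_of_length_le (by omega), hu1, hent]
  · rw [Qtab_eq hw, hone, hu2]

/-! ### Part F: combinatorial straightening -/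

def colP {N : ℕ} (pos : Fin N → ℕ × ℕ) : Finset (Equiv.Perm (Fin N)) :=
  Finset.univ.filter fun σ => ∀ a, (pos (σ a)).2 = (pos a).2

def fixP {N : ℕ} (Z : Finset (Fin N)) : Finset (Equiv.Perm (Fin N)) :=
  Finset.univ.filter fun σ => ∀ a, a ∉ Z → σ a = a

def BijP {N : ℕ} (ν : YoungDiagram) (pos : Fin N → ℕ × ℕ) : Prop :=
  Function.Injective pos ∧ ∀ c, c ∈ ν.cells ↔ ∃ a, pos a = c

def StdP {N : ℕ} (pos : Fin N → ℕ × ℕ) : Prop :=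
  ∀ a b, pos a ≠ pos b → (pos a).1 ≤ (pos b).1 → (pos a).2 ≤ (pos b).2 → a < b

theorem mem_colP {N} {pos : Fin N → ℕ × ℕ} {σ} : σ ∈ colP pos ↔ ∀ a, (pos (σ a)).2 = (pos a).2 := by
  simp [colP]

theorem mem_fixP {N} {Z : Finset (Fin N)} {σ} : σ ∈ fixP Z ↔ ∀ a, a ∉ Z → σ a = a := by
  simp [fixP]

theorem colP_inv {N} {pos : Fin N → ℕ × ℕ} {σ} (h : σ ∈ colP pos) (a) :
    (pos (σ⁻¹ a)).2 = (pos a).2 := by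
  have := mem_colP.1 h (σ⁻¹ a)
  simpa using this.symm

theorem BijP.comp {N} {ν} {pos : Fin N → ℕ × ℕ} (h : BijP ν pos) (π : Equiv.Perm (Fin N)) :
    BijP ν (fun a => pos (π⁻¹ a)) := by
  refine ⟨fun a b hab => π⁻¹.injective (h.1 hab), fun c => ?_⟩
  rw [h.2]
  constructor
  · rintro ⟨a, rfl⟩; exact ⟨π a, by simp⟩
  · rintro ⟨a, rfl⟩; exact ⟨_, rfl⟩

theorem swap_sum {N} (f : Fin N → ℕ) (x y : Fin N) (hyx : y < x) (hf : f x < f y) :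
    ∑ a : Fin N, (a : ℕ) * f a < ∑ a, (Equiv.swap x y a : ℕ) * f a := by
  have hne : y ≠ x := hyx.ne
  have key : ∀ g : Fin N → ℕ, ∑ a, g a = g x + (g y + ∑ a ∈ (Finset.univ.erase x).erase y, g a) := by
    intro g
    rw [Finset.add_sum_erase _ _ (by simp [hne]), Finset.add_sum_erase _ _ (by simp)]
  rw [key, key (fun a => (Equiv.swap x y a : ℕ) * f a)]
  have : ∑ a ∈ (Finset.univ.erase x).erase y, (Equiv.swap x y a : ℕ) * f a =
      ∑ a ∈ (Finset.univ.erase x).erase y, (a : ℕ) * f a := by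
    apply Finset.sum_congr rfl
    intro a ha
    simp only [Finset.mem_erase, Finset.mem_univ, and_true] at ha
    rw [Equiv.swap_apply_of_ne_of_ne ha.2 ha.1]
  rw [this]
  simp only [Equiv.swap_apply_left, Equiv.swap_apply_right]
  have h1 : (y : ℕ) < x := hyx
  obtain ⟨p, hp⟩ := Nat.exists_eq_add_of_lt h1
  obtain ⟨s, hs⟩ := Nat.exists_eq_add_of_lt hf
  rw [hp, hs]
  nlinarith

theorem std_of_adj {N} {ν} {pos : Fin N → ℕ × ℕ} (h : BijP ν pos)
    (hcol : ∀ x y, (pos x).2 = (pos y).2 → (pos x).1 < (pos y).1 → x < y)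
    (hrow : ∀ x y r j, pos x = (r, j) → pos y = (r, j+1) → x < y) : StdP pos := by
  have hrow' : ∀ d x y r j, pos x = (r, j) → pos y = (r, j+d+1) → x < y := by
    intro d
    induction d with
    | zero => intro x y r j h1 h2; exact hrow x y r j h1 h2
    | succ d ih =>
      intro x y r j h1 h2
      have hm : (r, j+d+1) ∈ ν.cells := by
        have : (r, j+(d+1)+1) ∈ ν.cells := (h.2 _).2 ⟨y, h2⟩
        exact ν.up_left_mem le_rfl (by omega) this
      obtain ⟨z, hz⟩ := (h.2 _).1 hm
      exact (ih x z r j h1 hz).trans (hrow z y r _ hz h2)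
  intro a b hne h1 h2
  have hrow'' : ∀ x y, (pos x).1 = (pos y).1 → (pos x).2 < (pos y).2 → x < y := by
    intro x y h1 h2
    obtain ⟨d, hd⟩ := Nat.exists_eq_add_of_lt h2
    exact hrow' d x y (pos x).1 (pos x).2 rfl (Prod.ext h1.symm hd)
  rcases h1.lt_or_eq with h1' | h1'
  · rcases h2.lt_or_eq with h2' | h2'
    · have hm : ((pos a).1, (pos b).2) ∈ ν.cells := by
        have : ((pos b).1, (pos b).2) ∈ ν.cells := (h.2 _).2 ⟨b, rfl⟩
        exact ν.up_left_mem h1 le_rfl this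
      obtain ⟨z, hz⟩ := (h.2 _).1 hm
      exact (hrow'' a z (by rw [hz]) (by rw [hz]; exact h2')).trans
        (hcol z b (by rw [hz]) (by rw [hz]; exact h1'))
    · exact hcol a b h2' h1'
  · rcases h2.lt_or_eq with h2' | h2'
    · exact hrow'' a b h1' h2'
    · exact absurd (Prod.ext h1' h2') hne

theorem sum_lt_image {N} (B : Finset (Fin N)) (π : Equiv.Perm (Fin N)) (x y : Fin N) (hyx : y < x)
    (hB : ∀ b ∈ B, b ≤ y) (hA : ∀ b ∈ B, π b ∉ B → x ≤ π b) (hbad : ∃ b ∈ B, π b ∉ B) :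
    ∑ b ∈ B, (b : ℕ) < ∑ b ∈ B, (π b : ℕ) := by
  set X := B.image π with hX
  have h1 : ∑ b ∈ B, (π b : ℕ) = ∑ b ∈ X, (b : ℕ) := by
    rw [hX, Finset.sum_image]
    intro a _ b _ h; exact π.injective h
  have hcard : X.card = B.card := Finset.card_image_of_injective _ π.injective
  have h2 : (X \ B).card = (B \ X).card := Finset.card_sdiff_comm hcard
  rw [h1, ← Finset.sum_inter_add_sum_sdiff X B, ← Finset.sum_inter_add_sum_sdiff B X,
    Finset.inter_comm B X]
  have h3 : (X \ B).card * (x : ℕ) ≤ ∑ b ∈ X \ B, (b : ℕ) := by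
    rw [← smul_eq_mul]
    apply Finset.card_nsmul_le_sum
    intro a ha
    simp only [Finset.mem_sdiff, hX, Finset.mem_image] at ha
    obtain ⟨⟨b, hb, rfl⟩, hn⟩ := ha
    exact hA b hb hn
  have h4 : ∑ b ∈ B \ X, (b : ℕ) ≤ (B \ X).card * (y : ℕ) := by
    rw [← smul_eq_mul]
    apply Finset.sum_le_card_nsmul
    intro a ha
    exact hB a (Finset.mem_sdiff.1 ha).1
  have h5 : 0 < (X \ B).card := by
    obtain ⟨b, hb, hn⟩ := hbad
    apply Finset.card_pos.2
    exact ⟨π b, by simp [hX, hb, hn]⟩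
  have h6 : (y : ℕ) < x := hyx
  rw [← h2] at h4
  have := Nat.mul_lt_mul_of_pos_left h6 h5
  omega

def Wt {N : ℕ} (pos : Fin N → ℕ × ℕ) : ℕ := ∑ a : Fin N, (a : ℕ) * (pos a).2

theorem Wt_comp {N} (pos : Fin N → ℕ × ℕ) (π : Equiv.Perm (Fin N)) :
    Wt (fun a => pos (π⁻¹ a)) = ∑ a : Fin N, (π a : ℕ) * (pos a).2 := by
  unfold Wt
  rw [← Equiv.sum_comp π (fun a : Fin N => (a : ℕ) * (pos (π⁻¹ a)).2)]
  simp

theorem sort_col {N} (pos : Fin N → ℕ × ℕ) : ∃ σ ∈ colP pos, ∀ x y,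
    (pos (σ⁻¹ x)).2 = (pos (σ⁻¹ y)).2 → (pos (σ⁻¹ x)).1 < (pos (σ⁻¹ y)).1 → x < y := by
  obtain ⟨σ, hσ, hmax⟩ := Finset.exists_max_image (colP pos)
    (fun σ => ∑ a : Fin N, (a : ℕ) * (pos (σ⁻¹ a)).1) ⟨1, by simp [mem_colP]⟩
  refine ⟨σ, hσ, fun x y h1 h2 => ?_⟩
  by_contra hc
  have hyx : y < x := by
    rcases lt_trichotomy x y with h | h | h
    · exact absurd h hc
    · subst h; omega
    · exact h
  have hmem : Equiv.swap x y * σ ∈ colP pos := by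
    rw [mem_colP]
    intro a
    rw [Equiv.Perm.mul_apply]
    have h3 := mem_colP.1 hσ a
    by_cases hx : σ a = x
    · rw [hx, Equiv.swap_apply_left]
      rw [hx] at h3
      rw [← h3, ← colP_inv hσ, ← colP_inv hσ x, h1]
    · by_cases hy : σ a = y
      · rw [hy, Equiv.swap_apply_right]
        rw [hy] at h3
        rw [← h3, ← colP_inv hσ, ← colP_inv hσ y, h1]
      · rw [Equiv.swap_apply_of_ne_of_ne hx hy, h3]
  have h3 := hmax _ hmem
  have h4 := swap_sum (fun a => (pos (σ⁻¹ a)).1) x y hyx h2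
  have h5 : ∑ a : Fin N, (a : ℕ) * (pos ((Equiv.swap x y * σ)⁻¹ a)).1 =
      ∑ a, (Equiv.swap x y a : ℕ) * (pos (σ⁻¹ a)).1 := by
    rw [← Equiv.sum_comp (Equiv.swap x y) (fun a : Fin N => (a : ℕ) * (pos ((Equiv.swap x y * σ)⁻¹ a)).1)]
    simp
  rw [h5] at h3
  omega

theorem garnir_pigeon {N} {ν} {pos : Fin N → ℕ × ℕ} (h : BijP ν pos) (r j : ℕ)
    (hrj : (r, j+1) ∈ ν.cells) (Z : Finset (Fin N))
    (hZ : ∀ a, a ∈ Z ↔ ((pos a).2 = j ∧ r ≤ (pos a).1) ∨ ((pos a).2 = j+1 ∧ (pos a).1 ≤ r))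
    (σ) (hσ : σ ∈ colP pos) :
    ∃ x ∈ Z, ∃ y ∈ Z, x ≠ y ∧ (pos (σ⁻¹ x)).1 = (pos (σ⁻¹ y)).1 := by
  have hcard : (Finset.range (ν.colLen j)).card < Z.card := by
    have hinv : ∀ i : ℕ, ∃ a : Fin N, i ∈ Finset.range (ν.colLen j + 1) →
        pos a = if i ≤ r then (i, j+1) else (i-1, j) := by
      intro i
      obtain ⟨a0, -⟩ := (h.2 _).1 hrj
      by_cases hi : i ∈ Finset.range (ν.colLen j + 1)
      · have : (if i ≤ r then (i, j+1) else (i-1, j)) ∈ ν.cells := by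
          split
          · rename_i h1
            exact ν.up_left_mem h1 le_rfl hrj
          · rw [YoungDiagram.mem_cells, YoungDiagram.mem_iff_lt_colLen]
            simp at hi; omega
        obtain ⟨a, ha⟩ := (h.2 _).1 this
        exact ⟨a, fun _ => ha⟩
      · exact ⟨a0, fun h => absurd h hi⟩
    choose g hg using hinv
    have h1 : (Finset.range (ν.colLen j + 1)).card ≤ Z.card := by
      apply Finset.card_le_card_of_injOn g
      · intro i hi
        have := hg i hi
        simp only [Finset.mem_coe]
        rw [hZ, this]
        split
        · right; simpa
        · left; simp; omega
      · intro i hi i' hi' hh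
        have h1 := hg i hi
        have h2 := hg i' hi'
        rw [hh, h2] at h1
        split at h1 <;> split at h1 <;> simp at h1 <;> omega
    simp at h1 ⊢
    omega
  obtain ⟨x, hx, y, hy, hne, he⟩ := Finset.exists_ne_map_eq_of_card_lt_of_maps_to hcard
    (f := fun a => (pos (σ⁻¹ a)).1) (by
      intro a ha
      have h1 : pos (σ⁻¹ a) ∈ ν.cells := (h.2 _).2 ⟨_, rfl⟩
      have h2 := colP_inv hσ a
      simp only [Finset.coe_range, Set.mem_Iio]
      rw [← YoungDiagram.mem_iff_lt_colLen]
      have h3 : ((pos (σ⁻¹ a)).1, (pos (σ⁻¹ a)).2) ∈ ν := h1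
      refine ν.up_left_mem le_rfl ?_ h3
      rw [h2]
      rcases (hZ a).1 ha with h4 | h4 <;> omega)
  exact ⟨x, hx, y, hy, hne, he⟩

theorem straight {N : ℕ} (ν : YoungDiagram) {V : Type} [AddCommGroup V] [Module ℚ V]
    (Φ : (Fin N → ℕ × ℕ) → V)
    (H1 : ∀ pos, ∀ σ ∈ colP pos, Φ (fun a => pos (σ⁻¹ a)) = (Equiv.Perm.sign σ : ℤ) • Φ pos)
    (H2 : ∀ pos (Z : Finset (Fin N)), (∀ σ ∈ colP pos, ∃ x ∈ Z, ∃ y ∈ Z, x ≠ y ∧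
      (pos (σ⁻¹ x)).1 = (pos (σ⁻¹ y)).1) →
      ∑ π ∈ fixP Z, (Equiv.Perm.sign π : ℤ) • Φ (fun a => pos (π⁻¹ a)) = 0)
    (pos) (hpos : BijP ν pos) :
    Φ pos ∈ Submodule.span ℚ {p | ∃ pos', BijP ν pos' ∧ StdP pos' ∧ p = Φ pos'} := by
  obtain ⟨M, hM⟩ : ∃ M, ∀ pos : Fin N → ℕ × ℕ, BijP ν pos → Wt pos ≤ M := by
    refine ⟨∑ a : Fin N, (a : ℕ) * ν.cells.sup Prod.snd, fun pos h => ?_⟩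
    apply Finset.sum_le_sum
    intro a _
    apply Nat.mul_le_mul_left
    exact Finset.le_sup (f := Prod.snd) ((h.2 _).2 ⟨a, rfl⟩)
  obtain ⟨k, hk⟩ : ∃ k, k = M - Wt pos := ⟨_, rfl⟩
  induction k using Nat.strong_induction_on generalizing pos with
  | _ k ih =>
  obtain ⟨σ, hσ, hsort⟩ := sort_col pos
  have hW : Wt (fun a => pos (σ⁻¹ a)) = Wt pos := by
    unfold Wt
    apply Finset.sum_congr rfl
    intro a _
    rw [colP_inv hσ]
  have hΦ := H1 pos σ hσ
  have hback : Φ pos = (Equiv.Perm.sign σ : ℤ) • Φ (fun a => pos (σ⁻¹ a)) := by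
    rw [hΦ, smul_smul]
    have : ((Equiv.Perm.sign σ : ℤ) * (Equiv.Perm.sign σ : ℤ)) = 1 := by
      rw [← Units.val_mul, ← sq, Int.units_sq]; rfl
    rw [this, one_smul]
  rw [hback]
  apply zsmul_mem
  have hpos' := hpos.comp σ
  rw [← hW] at hk
  have hsort' : ∀ x y, ((fun a => pos (σ⁻¹ a)) x).2 = ((fun a => pos (σ⁻¹ a)) y).2 →
    ((fun a => pos (σ⁻¹ a)) x).1 < ((fun a => pos (σ⁻¹ a)) y).1 → x < y := hsort
  clear hsort
  rename' hsort' => hsort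
  generalize (fun a => pos (σ⁻¹ a)) = ps at *
  clear hback hΦ hσ hW hpos
  by_cases hstd : StdP ps
  · exact Submodule.subset_span ⟨ps, hpos', hstd, rfl⟩
  obtain ⟨x, y, r, j, hx, hy, hyx⟩ : ∃ x y r j, ps x = (r, j) ∧ ps y = (r, j+1) ∧ y < x := by
    by_contra hc
    apply hstd
    apply std_of_adj hpos' hsort
    intro x y r j h1 h2
    rcases lt_trichotomy x y with h | h | h
    · exact h
    · subst h; rw [h1] at h2; simp at h2
    · exact absurd ⟨x, y, r, j, h1, h2, h⟩ hc
  set A : Finset (Fin N) := Finset.univ.filter fun a => (ps a).2 = j ∧ r ≤ (ps a).1 with hA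
  set B : Finset (Fin N) := Finset.univ.filter fun a => (ps a).2 = j+1 ∧ (ps a).1 ≤ r with hB
  have hmA : ∀ a, a ∈ A ↔ (ps a).2 = j ∧ r ≤ (ps a).1 := by intro a; simp [hA]
  have hmB : ∀ a, a ∈ B ↔ (ps a).2 = j+1 ∧ (ps a).1 ≤ r := by intro a; simp [hB]
  have hAx : ∀ a ∈ A, x ≤ a := by
    intro a ha
    rw [hmA] at ha
    by_cases h : a = x
    · exact h.ge
    · apply le_of_lt
      apply hsort
      · rw [hx, ha.1]
      · rw [hx]
        refine lt_of_le_of_ne ha.2 ?_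
        intro e
        apply h; apply hpos'.1; rw [hx]; exact Prod.ext e.symm ha.1
  have hBy : ∀ b ∈ B, b ≤ y := by
    intro a ha
    rw [hmB] at ha
    by_cases h : a = y
    · exact h.le
    · apply le_of_lt
      apply hsort
      · rw [hy, ha.1]
      · rw [hy]
        refine lt_of_le_of_ne ha.2 ?_
        intro e
        apply h; apply hpos'.1; rw [hy]; exact Prod.ext e ha.1
  have hG := H2 ps (A ∪ B) (fun σ hσ => garnir_pigeon hpos' r j ((hpos'.2 _).2 ⟨y, hy⟩) (A ∪ B)
    (by intro a; rw [Finset.mem_union, hmA, hmB]) σ hσ)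
  rw [← Finset.sum_filter_add_sum_filter_not (fixP (A ∪ B)) (fun π => ∀ b ∈ B, π b ∈ B)] at hG
  have hZmem : ∀ π ∈ fixP (A ∪ B), ∀ a ∈ A ∪ B, π a ∈ A ∪ B := by
    intro π hπ a ha
    by_contra hc
    have := mem_fixP.1 hπ _ hc
    have := π.injective this
    rw [this] at hc
    exact hc ha
  have hgood : ∑ π ∈ (fixP (A ∪ B)).filter (fun π => ∀ b ∈ B, π b ∈ B),
      (Equiv.Perm.sign π : ℤ) • Φ (fun a => ps (π⁻¹ a)) =
      ((fixP (A ∪ B)).filter (fun π => ∀ b ∈ B, π b ∈ B)).card • Φ ps := by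
    rw [← Finset.sum_const]
    apply Finset.sum_congr rfl
    intro π hπ
    rw [Finset.mem_filter] at hπ
    have himg : B.image π = B := by
      apply Finset.eq_of_subset_of_card_le
      · intro z hz
        rw [Finset.mem_image] at hz
        obtain ⟨b, hb, rfl⟩ := hz
        exact hπ.2 b hb
      · rw [Finset.card_image_of_injective _ π.injective]
    have hπc : π ∈ colP ps := by
      rw [mem_colP]
      intro a
      by_cases hb : a ∈ B
      · rw [((hmB _).1 hb).1, ((hmB _).1 (hπ.2 a hb)).1]
      · by_cases ha : a ∈ A
        · have h1 := hZmem π hπ.1 a (by simp [ha])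
          have h2 : π a ∉ B := by
            intro h
            rw [← himg, Finset.mem_image] at h
            obtain ⟨b, hb', e⟩ := h
            exact hb (π.injective e ▸ hb')
          have h3 : π a ∈ A := by
            rcases Finset.mem_union.1 h1 with h | h
            · exact h
            · exact absurd h h2
          rw [((hmA _).1 ha).1, ((hmA _).1 h3).1]
        · rw [mem_fixP.1 hπ.1 a (by simp [ha, hb])]
    rw [H1 ps π hπc, smul_smul]
    have : ((Equiv.Perm.sign π : ℤ) * (Equiv.Perm.sign π : ℤ)) = 1 := by
      rw [← Units.val_mul, ← sq, Int.units_sq]; rfl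
    rw [this, one_smul]
  have hbad : ∑ π ∈ (fixP (A ∪ B)).filter (fun π => ¬ ∀ b ∈ B, π b ∈ B),
      (Equiv.Perm.sign π : ℤ) • Φ (fun a => ps (π⁻¹ a)) ∈
      Submodule.span ℚ {p | ∃ pos', BijP ν pos' ∧ StdP pos' ∧ p = Φ pos'} := by
    apply Submodule.sum_mem
    intro π hπ
    rw [Finset.mem_filter] at hπ
    obtain ⟨hπ, hπ2⟩ := hπ
    push Not at hπ2
    apply zsmul_mem
    have hb' := hpos'.comp π
    have hlt : Wt ps < Wt (fun a => ps (π⁻¹ a)) := by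
      rw [Wt_comp]
      set col' : Fin N → ℕ := fun a => if a ∈ A ∪ B then j else (ps a).2 with hcol'
      have hcol : ∀ a, (ps a).2 = col' a + if a ∈ B then 1 else 0 := by
        intro a
        simp only [hcol']
        by_cases hb : a ∈ B
        · simp [hb, ((hmB _).1 hb).1]
        · by_cases ha : a ∈ A
          · simp [hb, ha, ((hmA _).1 ha).1]
          · simp [hb, ha]
      have hinv : ∀ a, col' a = col' (π a) := by
        intro a
        simp only [hcol']
        by_cases ha : a ∈ A ∪ B
        · rw [if_pos ha, if_pos (hZmem π hπ a ha)]
        · rw [mem_fixP.1 hπ a ha]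
      unfold Wt
      simp only [hcol, mul_add, Finset.sum_add_distrib]
      have e1 : ∑ a : Fin N, (π a : ℕ) * col' a = ∑ a : Fin N, (a : ℕ) * col' a := by
        rw [← Equiv.sum_comp π (fun a : Fin N => (a : ℕ) * col' a)]
        apply Finset.sum_congr rfl
        intro a _
        rw [← hinv a]
      rw [e1]
      have e2 : ∀ g : Fin N → ℕ, ∑ a, g a * (if a ∈ B then 1 else 0) = ∑ a ∈ B, g a := by
        intro g
        simp
      rw [e2 (fun a => (a : ℕ)), e2 (fun a => (π a : ℕ))]
      have := sum_lt_image B π x y hyx hBy (by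
        intro b hb hn
        have h1 := hZmem π hπ b (by simp [hb])
        rcases Finset.mem_union.1 h1 with h | h
        · exact hAx _ h
        · exact absurd h hn) hπ2
      omega
    have := hM _ hb'
    exact ih (M - Wt (fun a => ps (π⁻¹ a))) (by omega) _ hb' rfl
  rw [hgood] at hG
  set n := ((fixP (A ∪ B)).filter (fun π => ∀ b ∈ B, π b ∈ B)).card with hn
  have hn0 : 0 < n := by
    apply Finset.card_pos.2
    exact ⟨1, by simp [mem_fixP]⟩
  have h3 : (n : ℚ) • Φ ps ∈
      Submodule.span ℚ {p | ∃ pos', BijP ν pos' ∧ StdP pos' ∧ p = Φ pos'} := by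
    rw [Nat.cast_smul_eq_nsmul]
    rw [eq_neg_of_add_eq_zero_left hG]
    exact Submodule.neg_mem _ hbad
  have h4 := Submodule.smul_mem _ (n : ℚ)⁻¹ h3
  rwa [smul_smul, inv_mul_cancel₀ (by positivity), one_smul] at h4

/-! ### Part G: algebra of Young symmetrizers -/

theorem embedPerm_apply {N : ℕ} (g : Equiv.Perm (Fin N)) (a : Fin N) :
    embedPerm N g ((a : ℕ) + 1) = (g a : ℕ) + 1 :=
  Equiv.Perm.extendDomain_apply_image g (finShift N) a

theorem embedPerm_mul {N : ℕ} (g h : Equiv.Perm (Fin N)) :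
    embedPerm N (g * h) = embedPerm N g * embedPerm N h :=
  (Equiv.Perm.extendDomain_mul (finShift N) g h).symm

theorem embedPerm_out {N : ℕ} (g : Equiv.Perm (Fin N)) (i : ℕ) (hi : ¬ (1 ≤ i ∧ i ≤ N)) :
    embedPerm N g i = i :=
  Equiv.Perm.extendDomain_apply_not_subtype g (finShift N) hi

def rho (N : ℕ) (g : Equiv.Perm (Fin N)) : MvPolynomial ℕ ℚ →ₗ[ℚ] MvPolynomial ℕ ℚ :=
  (rename (⇑(embedPerm N g))).toLinearMap

theorem rho_apply {N} (g : Equiv.Perm (Fin N)) (p) : rho N g p = rename (⇑(embedPerm N g)) p := rfl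

theorem rho_mul {N} (g h : Equiv.Perm (Fin N)) (p) : rho N (g * h) p = rho N g (rho N h p) := by
  rw [rho_apply, rho_apply, rho_apply, rename_rename, embedPerm_mul]; rfl

def rowP {N : ℕ} (pos : Fin N → ℕ × ℕ) : Finset (Equiv.Perm (Fin N)) :=
  Finset.univ.filter fun σ => ∀ a, (pos (σ a)).1 = (pos a).1

theorem mem_rowP {N} {pos : Fin N → ℕ × ℕ} {σ} : σ ∈ rowP pos ↔ ∀ a, (pos (σ a)).1 = (pos a).1 := by
  simp [rowP]

def monP {N : ℕ} (h : ℕ × ℕ → ℕ) (pos : Fin N → ℕ × ℕ) : MvPolynomial ℕ ℚ :=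
  ∏ a : Fin N, X ((a : ℕ) + 1) ^ h (pos a)

def sP {N : ℕ} (h : ℕ × ℕ → ℕ) (pos : Fin N → ℕ × ℕ) : ℕ :=
  ((rowP pos).filter fun τ => rho N τ (monP h pos) = monP h pos).card

def rsP {N : ℕ} (pos : Fin N → ℕ × ℕ) (p : MvPolynomial ℕ ℚ) : MvPolynomial ℕ ℚ :=
  ∑ τ ∈ rowP pos, rho N τ p

def EP {N : ℕ} (pos : Fin N → ℕ × ℕ) (p : MvPolynomial ℕ ℚ) : MvPolynomial ℕ ℚ :=
  ∑ σ ∈ colP pos, (Equiv.Perm.sign σ : ℤ) • rho N σ (rsP pos p)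

def FP {N : ℕ} (h : ℕ × ℕ → ℕ) (pos : Fin N → ℕ × ℕ) : MvPolynomial ℕ ℚ :=
  ((sP h pos : ℚ)⁻¹) • EP pos (monP h pos)

def posF (N : ℕ) (T : Tab) : Fin N → ℕ × ℕ := fun a => posOf T ((a : ℕ) + 1)

theorem forall_Icc {N : ℕ} (Q : ℕ → Prop) : (∀ i ∈ Finset.Icc 1 N, Q i) ↔ ∀ a : Fin N, Q (a + 1) := by
  constructor
  · intro h a; exact h _ (by simp)
  · intro h i hi
    simp only [Finset.mem_Icc] at hi
    have := h ⟨i - 1, by omega⟩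
    simpa [show i - 1 + 1 = i by omega] using this

theorem rowFinset_eq (N T) : rowFinset N T = rowP (posF N T) := by
  ext τ
  rw [mem_rowP]
  simp only [rowFinset, Finset.mem_filter, Finset.mem_univ, true_and]
  rw [forall_Icc (fun i => rowIdx T (embedPerm N τ i) = rowIdx T i)]
  simp only [embedPerm_apply]
  rfl

theorem colFinset_eq (N T) : colFinset N T = colP (posF N T) := by
  ext τ
  rw [mem_colP]
  simp only [colFinset, Finset.mem_filter, Finset.mem_univ, true_and]
  rw [forall_Icc (fun i => colIdx T (embedPerm N τ i) = colIdx T i)]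
  simp only [embedPerm_apply]
  rfl

theorem pTS_eq (N T S) : pTS N T S = monP (ctEntry S (DsiSet N S)) (posF N T) := by
  unfold pTS monP
  rw [Finset.prod_fin_eq_prod_range]
  rw [show Finset.Icc 1 N = Finset.Ico 1 (N+1) by rfl, Finset.prod_Ico_eq_prod_range]
  apply Finset.prod_congr rfl
  intro i hi
  simp only [Nat.add_sub_cancel, Finset.mem_range] at hi
  rw [dif_pos hi, add_comm]
  rfl

theorem FTS_eq (N T S) : FTS N T S = FP (ctEntry S (DsiSet N S)) (posF N T) := by
  unfold FTS FP sTS sP epsAct EP rsP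
  rw [rowFinset_eq, colFinset_eq, pTS_eq]
  congr 1
  apply Finset.sum_congr rfl
  intro σ _
  rw [map_sum, Finset.smul_sum]
  apply Finset.sum_congr rfl
  intro τ _
  rw [← rho_mul, rho_apply, embedPerm_mul]

theorem mem_rowP_conj {N} {pos : Fin N → ℕ × ℕ} (π τ : Equiv.Perm (Fin N)) :
    τ ∈ rowP pos ↔ π * τ * π⁻¹ ∈ rowP (fun a => pos (π⁻¹ a)) := by
  rw [mem_rowP, mem_rowP]
  constructor
  · intro h a
    simpa using h (π⁻¹ a)
  · intro h a
    simpa using h (π a)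

theorem mem_colP_conj {N} {pos : Fin N → ℕ × ℕ} (π τ : Equiv.Perm (Fin N)) :
    τ ∈ colP pos ↔ π * τ * π⁻¹ ∈ colP (fun a => pos (π⁻¹ a)) := by
  rw [mem_colP, mem_colP]
  constructor
  · intro h a
    simpa using h (π⁻¹ a)
  · intro h a
    simpa using h (π a)

theorem rho_conj {N} (π τ : Equiv.Perm (Fin N)) (p) :
    rho N (π * τ * π⁻¹) (rho N π p) = rho N π (rho N τ p) := by
  rw [← rho_mul, ← rho_mul]; simp

theorem monP_comp {N} (h) (pos : Fin N → ℕ × ℕ) (π : Equiv.Perm (Fin N)) :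
    monP h (fun a => pos (π⁻¹ a)) = rho N π (monP h pos) := by
  unfold monP
  rw [rho_apply, map_prod, ← Equiv.prod_comp π]
  apply Finset.prod_congr rfl
  intro a _
  simp [embedPerm_apply]

theorem rsP_comp {N} (pos : Fin N → ℕ × ℕ) (π p) :
    rsP (fun a => pos (π⁻¹ a)) (rho N π p) = rho N π (rsP pos p) := by
  unfold rsP
  rw [map_sum]
  symm
  apply Finset.sum_equiv (MulAut.conj π).toEquiv
  · intro τ; exact mem_rowP_conj π τ
  · intro τ _; exact (rho_conj π τ p).symm

theorem EP_comp {N} (pos : Fin N → ℕ × ℕ) (π p) :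
    EP (fun a => pos (π⁻¹ a)) (rho N π p) = rho N π (EP pos p) := by
  unfold EP
  rw [map_sum]
  symm
  apply Finset.sum_equiv (MulAut.conj π).toEquiv
  · intro τ; exact mem_colP_conj π τ
  · intro τ _
    rw [rsP_comp, map_zsmul]
    show _ = ((Equiv.Perm.sign (π * τ * π⁻¹) : ℤˣ) : ℤ) • rho N (π * τ * π⁻¹) _
    rw [rho_conj]
    congr 2
    rw [Equiv.Perm.sign_mul, Equiv.Perm.sign_mul, Equiv.Perm.sign_inv, mul_right_comm, ← sq,
      Int.units_sq, one_mul]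

theorem rho_inj {N} (π : Equiv.Perm (Fin N)) : Function.Injective (rho N π) :=
  rename_injective _ (embedPerm N π).injective

theorem sP_comp {N} (h) (pos : Fin N → ℕ × ℕ) (π : Equiv.Perm (Fin N)) : sP h (fun a => pos (π⁻¹ a)) = sP h pos := by
  unfold sP
  symm
  apply Finset.card_equiv (MulAut.conj π).toEquiv
  intro τ
  show _ ↔ π * τ * π⁻¹ ∈ _
  rw [Finset.mem_filter, Finset.mem_filter, ← mem_rowP_conj, monP_comp, rho_conj]
  rw [(rho_inj π).eq_iff]

theorem FP_comp {N} (h) (pos : Fin N → ℕ × ℕ) (π : Equiv.Perm (Fin N)) :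
    FP h (fun a => pos (π⁻¹ a)) = rho N π (FP h pos) := by
  unfold FP
  rw [sP_comp, monP_comp, EP_comp, map_smul]

theorem EP_col {N} (pos : Fin N → ℕ × ℕ) (p σ) (hσ : σ ∈ colP pos) :
    rho N σ (EP pos p) = (Equiv.Perm.sign σ : ℤ) • EP pos p := by
  unfold EP
  rw [map_sum, Finset.smul_sum]
  apply Finset.sum_equiv (Equiv.mulLeft σ)
  · intro τ
    rw [mem_colP, mem_colP]
    have := mem_colP.1 hσ
    simp [this]
  · intro τ _
    rw [map_zsmul, smul_smul, Equiv.coe_mulLeft, rho_mul]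
    congr 1
    rw [Equiv.Perm.sign_mul, Units.val_mul, ← mul_assoc, ← Units.val_mul, ← sq, Int.units_sq]
    simp

theorem rs_row {N} (pos : Fin N → ℕ × ℕ) (p τ) (hτ : τ ∈ rowP pos) :
    rho N τ (rsP pos p) = rsP pos p := by
  unfold rsP
  rw [map_sum]
  apply Finset.sum_equiv (Equiv.mulLeft τ)
  · intro s
    rw [mem_rowP, mem_rowP]
    have := mem_rowP.1 hτ
    simp [this]
  · intro s _
    rw [Equiv.coe_mulLeft, rho_mul]

theorem EP_garnir {N} (pos : Fin N → ℕ × ℕ) (p) (Z : Finset (Fin N))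
    (hZ : ∀ σ ∈ colP pos, ∃ x ∈ Z, ∃ y ∈ Z, x ≠ y ∧ (pos (σ⁻¹ x)).1 = (pos (σ⁻¹ y)).1) :
    ∑ π ∈ fixP Z, (Equiv.Perm.sign π : ℤ) • rho N π (EP pos p) = 0 := by
  unfold EP
  simp only [map_sum, Finset.smul_sum]
  rw [Finset.sum_comm]
  apply Finset.sum_eq_zero
  intro σ hσ
  obtain ⟨x, hx, y, hy, hne, hr⟩ := hZ σ hσ
  set t := Equiv.swap x y with ht
  have hrow : σ⁻¹ * t * σ ∈ rowP pos := by
    have e : σ⁻¹ * t * σ = Equiv.swap (σ⁻¹ x) (σ⁻¹ y) := by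
      have := Equiv.swap_apply_apply (σ⁻¹) x y
      rw [this]; simp [ht]
    rw [e, mem_rowP]
    intro a
    by_cases h1 : a = σ⁻¹ x
    · subst h1; rw [Equiv.swap_apply_left, hr]
    · by_cases h2 : a = σ⁻¹ y
      · subst h2; rw [Equiv.swap_apply_right, hr]
      · rw [Equiv.swap_apply_of_ne_of_ne h1 h2]
  have hinv : rho N t (rho N σ (rsP pos p)) = rho N σ (rsP pos p) := by
    conv_rhs => rw [← rs_row pos p _ hrow]
    rw [← rho_mul, ← rho_mul]
    congr 2
    group
  have hsum : ∑ π ∈ fixP Z, (Equiv.Perm.sign π : ℤ) • rho N π ((Equiv.Perm.sign σ : ℤ) • rho N σ (rsP pos p))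
      = - ∑ π ∈ fixP Z, (Equiv.Perm.sign π : ℤ) • rho N π ((Equiv.Perm.sign σ : ℤ) • rho N σ (rsP pos p)) := by
    rw [← Finset.sum_neg_distrib]
    apply Finset.sum_equiv (Equiv.mulRight t)
    · intro π
      rw [mem_fixP, mem_fixP]
      have ht' : ∀ a, a ∉ Z → t a = a := by
        intro a ha
        apply Equiv.swap_apply_of_ne_of_ne
        · rintro rfl; exact ha hx
        · rintro rfl; exact ha hy
      constructor
      · intro h a ha
        simp [ht' a ha, h a ha]
      · intro h a ha
        have := h a ha
        simpa [ht' a ha] using this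
    · intro π _
      rw [Equiv.coe_mulRight, rho_mul, map_zsmul (rho N t), hinv, Equiv.Perm.sign_mul,
        ht, Equiv.Perm.sign_swap hne]
      simp
  exact self_eq_neg.1 hsum

theorem FP_straight {N : ℕ} (ν : YoungDiagram) (h : ℕ × ℕ → ℕ) (pos : Fin N → ℕ × ℕ)
    (hpos : BijP ν pos) :
    FP h pos ∈ Submodule.span ℚ {p | ∃ pos' : Fin N → ℕ × ℕ, BijP ν pos' ∧ StdP pos' ∧ p = FP h pos'} := by
  apply straight ν (FP h) _ _ pos hpos
  · intro pos σ hσ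
    rw [FP_comp]
    unfold FP
    rw [map_smul, EP_col _ _ _ hσ, smul_comm]
  · intro pos Z hZ
    simp only [FP_comp]
    unfold FP
    simp only [map_smul]
    have := EP_garnir pos (monP h pos) Z hZ
    calc _ = ((sP h pos : ℚ)⁻¹) • ∑ π ∈ fixP Z, (Equiv.Perm.sign π : ℤ) • rho N π (EP pos (monP h pos)) := by
          rw [Finset.smul_sum]
          apply Finset.sum_congr rfl
          intro π _
          rw [smul_comm]
      _ = 0 := by rw [this, smul_zero]

/-! fillings and positions -/

theorem posOf_filling {cells : Finset (ℕ × ℕ)} {T : Tab} (hT : IsFillingF cells T) {c} (hc : c ∈ cells) :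
    posOf T (T c) = c := by
  have h0 : 1 ≤ T c := (hT.2.mapsTo hc).1
  have huniq : ∀ c', T c' = T c → c' = c := by
    intro c' h
    have hc' : c' ∈ cells := by
      by_contra hn
      have := hT.1 c' hn
      omega
    exact hT.2.injOn hc' hc h
  have hrow : rowIdx T (T c) = c.1 := by
    unfold rowIdx
    have : {r | ∃ c_1, T (r, c_1) = T c} = {c.1} := by
      ext r
      simp only [Set.mem_setOf_eq, Set.mem_singleton_iff]
      constructor
      · rintro ⟨d, hd⟩
        rw [← huniq _ hd]
      · rintro rfl; exact ⟨c.2, rfl⟩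
    rw [this]; simp
  have hcol : colIdx T (T c) = c.2 := by
    unfold colIdx
    rw [hrow]
    have : {d | T (c.1, d) = T c} = {c.2} := by
      ext r
      simp only [Set.mem_setOf_eq, Set.mem_singleton_iff]
      constructor
      · intro hd
        rw [← huniq _ hd]
      · rintro rfl; rfl
    rw [this]; simp
  exact Prod.ext hrow hcol

theorem posF_bij {ν : YoungDiagram} {T : Tab} {N} (hN : ν.cells.card = N) (hT : IsFillingF ν.cells T) :
    BijP ν (posF N T) := by
  have hsurj : ∀ a : Fin N, ∃ c ∈ ν.cells, T c = a + 1 := by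
    intro a
    obtain ⟨c, hc, h⟩ := hT.2.surjOn (show (a : ℕ) + 1 ∈ Set.Icc 1 ν.cells.card by
      rw [hN]; simp)
    exact ⟨c, hc, h⟩
  constructor
  · intro a b hab
    obtain ⟨c, hc, h1⟩ := hsurj a
    obtain ⟨d, hd, h2⟩ := hsurj b
    unfold posF at hab
    rw [← h1, ← h2, posOf_filling hT hc, posOf_filling hT hd] at hab
    subst hab
    apply Fin.ext
    omega
  · intro c
    constructor
    · intro hc
      have := hT.2.mapsTo hc
      rw [hN] at this
      obtain ⟨t1, t2⟩ := this
      refine ⟨⟨T c - 1, by omega⟩, ?_⟩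
      unfold posF
      simp only
      rw [show T c - 1 + 1 = T c by omega, posOf_filling hT hc]
    · rintro ⟨a, rfl⟩
      obtain ⟨c, hc, h1⟩ := hsurj a
      unfold posF
      rw [← h1, posOf_filling hT hc]
      exact hc

def tabP {N : ℕ} (pos : Fin N → ℕ × ℕ) : Tab := fun c =>
  if h : ∃ a, pos a = c then (h.choose : ℕ) + 1 else 0

theorem tabP_pos {N} {pos : Fin N → ℕ × ℕ} (h : Function.Injective pos) (a) : tabP pos (pos a) = a + 1 := by
  have hex : ∃ b, pos b = pos a := ⟨a, rfl⟩
  unfold tabP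
  rw [dif_pos hex, h hex.choose_spec]

theorem tabP_filling {N} {ν : YoungDiagram} (hN : ν.cells.card = N) {pos : Fin N → ℕ × ℕ} (h : BijP ν pos) :
    IsFillingF ν.cells (tabP pos) := by
  constructor
  · intro c hc
    rw [h.2] at hc
    unfold tabP
    rw [dif_neg hc]
  · rw [hN]
    refine ⟨?_, ?_, ?_⟩
    · intro c hc
      obtain ⟨a, rfl⟩ := (h.2 c).1 hc
      rw [tabP_pos h.1]; simp
    · intro c hc d hd hcd
      obtain ⟨a, rfl⟩ := (h.2 c).1 hc
      obtain ⟨b, rfl⟩ := (h.2 d).1 hd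
      rw [tabP_pos h.1, tabP_pos h.1] at hcd
      congr 1
      apply Fin.ext; omega
    · intro x hx
      refine ⟨pos ⟨x - 1, by have := hx.1; have := hx.2; omega⟩, (h.2 _).2 ⟨_, rfl⟩, ?_⟩
      rw [tabP_pos h.1]
      have := hx.1
      simp only; omega

theorem posF_tabP {N} {ν : YoungDiagram} (hN : ν.cells.card = N) {pos : Fin N → ℕ × ℕ} (h : BijP ν pos) :
    posF N (tabP pos) = pos := by
  funext a
  unfold posF
  rw [← tabP_pos h.1, posOf_filling (tabP_filling hN h) ((h.2 _).2 ⟨a, rfl⟩)]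

theorem FTS_straight {ν : YoungDiagram} {T S : Tab} {N} (hN : ν.cells.card = N)
    (hT : IsFillingF ν.cells T) :
    FTS N T S ∈ Submodule.span ℚ {p | ∃ T' : Tab, IsStandard ν T' ∧ p = FTS N T' S} := by
  rw [FTS_eq]
  refine Submodule.span_mono ?_ (FP_straight ν _ _ (posF_bij hN hT))
  rintro p ⟨pos, h1, h2, rfl⟩
  refine ⟨tabP pos, ⟨tabP_filling hN h1, ?_⟩, ?_⟩
  · intro c hc d hd hne hr hcl
    obtain ⟨a, rfl⟩ := (h1.2 c).1 hc
    obtain ⟨b, rfl⟩ := (h1.2 d).1 hd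
    rw [tabP_pos h1.1, tabP_pos h1.1]
    have : a < b := h2 a b hne hr hcl
    have : (a : ℕ) < b := this
    omega
  · rw [FTS_eq, posF_tabP hN h1]

theorem esym_zero' (N : ℕ) : esym N 0 = 1 := by
  simp [esym]

theorem rIdxI_insert (n : ℕ) (I : Finset ℕ) : rIdxI (n + 1) (insert n I) = rIdxI n I := by
  funext i
  unfold rIdxI
  congr 1
  ext j
  simp only [Finset.mem_filter, Finset.mem_sdiff, Finset.mem_Ioo, Finset.mem_insert, not_or]
  constructor
  · rintro ⟨⟨h1, h2, h3⟩, h4⟩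
    exact ⟨⟨⟨h1.1, by omega⟩, h3⟩, h4⟩
  · rintro ⟨⟨h1, h3⟩, h4⟩
    exact ⟨⟨⟨h1.1, by omega⟩, by omega, h3⟩, h4⟩

theorem rIdxI_self (n k : ℕ) (I : Finset ℕ) (hI : I ⊆ Finset.Ioo 0 n)
    (hIcard : I.card = k - 1) (hk : 1 ≤ k) (hkn : k ≤ n) : rIdxI n I n = n - k := by
  unfold rIdxI
  rw [Finset.filter_true_of_mem, Finset.card_sdiff_of_subset hI, Nat.card_Ioo, hIcard]
  · omega
  · intro j hj
    simp only [Finset.mem_sdiff, Finset.mem_Ioo] at hj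
    exact hj.1.2

theorem rIdxI_le (n : ℕ) (I : Finset ℕ) (i : ℕ) : rIdxI n I i ≤ n := by
  unfold rIdxI
  refine (Finset.card_filter_le _ _).trans ((Finset.card_le_card Finset.sdiff_subset).trans ?_)
  simp

theorem eProd_addAt (N : ℕ) (h : ℕ → ℕ) (t δ : ℕ) (ht : t ≤ N) :
    eProd N (addAt h t δ) = eProd N h * esym N t ^ δ := by
  unfold eProd addAt
  by_cases h0 : t = 0
  · subst h0
    simp [esym_zero']
  · have : ∀ r, esym N r ^ (if r = t ∧ 1 ≤ t then h r + δ else h r)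
        = esym N r ^ h r * (if r = t then esym N t ^ δ else 1) := by
      intro r
      by_cases hr : r = t
      · subst hr
        rw [if_pos ⟨rfl, by omega⟩, if_pos rfl, pow_add]
      · rw [if_neg (by tauto), if_neg hr, mul_one]
    simp only [this]
    rw [Finset.prod_mul_distrib, Finset.prod_ite_eq', if_pos]
    simp; omega

theorem eProd_hSI (n N : ℕ) (hN : n ≤ N) (I : Finset ℕ) (S : Tab) :
    eProd N (hSI n I S) = ∏ i ∈ I \ Dsic n S, esym N (rIdxI n I i) := by
  rw [← Finset.prod_fiberwise_of_maps_to (t := Finset.Icc 0 N) (g := rIdxI n I)]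
  · rw [← Finset.insert_Icc_succ_left_eq_Icc (Nat.zero_le N), Finset.prod_insert (by simp)]
    rw [Finset.prod_eq_one (s := (I \ Dsic n S).filter _), one_mul]
    · apply Finset.prod_congr rfl
      intro r hr
      unfold hSI
      rw [if_pos (by simp at hr; omega), Finset.prod_congr rfl (g := fun _ => esym N r),
        Finset.prod_const]
      intro i hi
      rw [(Finset.mem_filter.mp hi).2]
    · intro i hi
      rw [(Finset.mem_filter.mp hi).2, esym_zero']
  · intro i _
    have := rIdxI_le n I i
    simp; omega

theorem eProd_hInd (n N : ℕ) (hN : n ≤ N) (I : Finset ℕ) (hI : I ⊆ Finset.Ioo 0 n) (S : Tab) :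
    eProd N (hInd n I S) = ∏ i ∈ I \ Dsic n S, esym N i := by
  unfold eProd hInd
  have : ∀ r, esym N r ^ (if r ∈ I \ Dsic n S then 1 else 0)
      = if r ∈ I \ Dsic n S then esym N r else 1 := by
    intro r; split_ifs <;> simp
  simp only [this]
  rw [Finset.prod_ite_mem, Finset.inter_eq_right.mpr]
  intro i hi
  have := hI (Finset.mem_sdiff.mp hi).1
  simp at this ⊢
  omega

/-- descents after appending a box -/
theorem DsiSet_snoc {n : ℕ} (hn : 1 ≤ n) {q : List (ℕ × ℕ)} {v : ℕ × ℕ} (hl : q.length = n)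
    (hq : (q ++ [v]).Nodup) :
    DsiSet (n + 1) (tabOf (q ++ [v])) =
      if rowIdx (tabOf q) n < v.1 then insert n (DsiSet n (tabOf q)) else DsiSet n (tabOf q) := by
  have hq' : q.Nodup := (List.nodup_append.mp hq).1
  have hlast : ∃ c, q[n-1]? = some c := by
    have : n - 1 < q.length := by omega
    exact ⟨q[n-1], List.getElem?_eq_getElem this⟩
  obtain ⟨c, hc⟩ := hlast
  have hrow := rowIdx_tabOf hq' (n-1) c hc
  rw [Nat.sub_add_cancel hn] at hrow
  have hdn : isD (q ++ [v]) (n - 1) ↔ c.1 < v.1 := by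
    unfold isD
    rw [List.getElem?_append_left (by omega), Nat.sub_add_cancel hn,
      List.getElem?_append_right (by omega), hc, hl]
    simp
  have key : ∀ i, i ∈ DsiSet (n + 1) (tabOf (q ++ [v])) ↔
      i ∈ DsiSet n (tabOf q) ∨ (i = n ∧ c.1 < v.1) := by
    intro i
    rw [mem_DsiSet_tabOf hq (by simp [hl]), mem_DsiSet_tabOf hq' hl]
    by_cases hi : i = n
    · subst hi
      rw [hdn]
      have : ¬ isD q (i - 1) := by
        rintro ⟨a, b, h1, h2, h3⟩
        rw [Nat.sub_add_cancel hn, List.getElem?_eq_none (by omega)] at h2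
        simp at h2
      tauto
    · by_cases h1 : 1 ≤ i
      · have : isD (q ++ [v]) (i - 1) ↔ isD q (i - 1) := by
          by_cases hlt : i < n
          · unfold isD
            rw [List.getElem?_append_left (by omega), List.getElem?_append_left (by omega)]
          · unfold isD
            rw [List.getElem?_eq_none (l := q ++ [v]) (i := i - 1 + 1) (by simp; omega),
              List.getElem?_eq_none (l := q) (i := i - 1 + 1) (by omega)]
            simp
        tauto
      · tauto
  rw [hrow]
  ext i
  rw [key]
  split_ifs with h
  · rw [Finset.mem_insert]; tauto
  · tauto

theorem DsiSet_sub (n : ℕ) (T : Tab) : DsiSet n T ⊆ Finset.Ioo 0 n := Finset.filter_subset _ _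

theorem prod_snoc {n : ℕ} (hn : 1 ≤ n) {q : List (ℕ × ℕ)} {v : ℕ × ℕ} (hl : q.length = n)
    (hq : (q ++ [v]).Nodup) (I : Finset ℕ) (hI : I ⊆ Finset.Ioo 0 n)
    (g : ℕ → MvPolynomial ℕ ℚ) :
    ∏ i ∈ insert n I \ DsiSet (n + 1) (tabOf (q ++ [v])), g i =
      (∏ i ∈ I \ DsiSet n (tabOf q), g i) *
        g n ^ (if rowIdx (tabOf q) n < v.1 then 0 else 1) := by
  rw [DsiSet_snoc hn hl hq]
  have hnI : n ∉ I := fun h => by have := hI h; simp at this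
  have hnD : n ∉ DsiSet n (tabOf q) := fun h => by have := DsiSet_sub _ _ h; simp at this
  split_ifs with h
  · rw [pow_zero, mul_one]
    congr 1
    ext i
    simp only [Finset.mem_sdiff, Finset.mem_insert]
    constructor
    · tauto
    · rintro ⟨h1, h2⟩
      refine ⟨Or.inr h1, ?_⟩
      rintro (rfl | h3)
      · exact hnI h1
      · exact h2 h3
  · rw [pow_one, Finset.insert_sdiff_of_notMem _ hnD, Finset.prod_insert, mul_comm]
    simp [hnI]

theorem DsiSet_snoc_sub {n : ℕ} (hn : 1 ≤ n) {q : List (ℕ × ℕ)} {v : ℕ × ℕ} (hl : q.length = n)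
    (hq : (q ++ [v]).Nodup) (I : Finset ℕ) :
    DsiSet (n + 1) (tabOf (q ++ [v])) ⊆ insert n I ↔ DsiSet n (tabOf q) ⊆ I := by
  rw [DsiSet_snoc hn hl hq]
  have hnD : n ∉ DsiSet n (tabOf q) := fun h => by have := DsiSet_sub _ _ h; simp at this
  have : DsiSet n (tabOf q) ⊆ insert n I ↔ DsiSet n (tabOf q) ⊆ I :=
    Finset.subset_insert_iff_of_notMem hnD
  split_ifs with h
  · rw [Finset.insert_subset_iff, this]; simp
  · exact this

theorem Sadd_tabOf {n : ℕ} {s : List (ℕ × ℕ)} {v : ℕ × ℕ} (hl : s.length = n)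
    (hv : Valid ∅ s) (hvs : v ∉ evW n s) :
    Sadd n (tabOf s) v = evac (n + 1) (tabOf (evW n s ++ [v])) := by
  unfold Sadd evac
  rw [evac_tabOf n s hl hv, tabOf_snoc _ v hvs, evW_length n s hl]

theorem main_generic (n : ℕ) (hn : 1 ≤ n) (t : ℕ) (I : Finset ℕ) (hI : I ⊆ Finset.Ioo 0 n)
    (g : ℕ → MvPolynomial ℕ ℚ) (h : Tab → ℕ → ℕ)
    (hgh : ∀ S δ, eProd (n + 1) (addAt (h S) t δ) = (∏ i ∈ I \ Dsic n S, g i) * g n ^ δ) :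
    Submodule.span ℚ {p | ∃ w : Equiv.Perm ℕ, SuppIn (n + 1) w ∧ DslSet (n + 1) w ⊆ insert n I ∧
      p = Fw (n + 1) w * ∏ i ∈ insert n I \ DslSet (n + 1) w, g i} =
    ⨆ q : SIdx n I, IndVSh t n q.1.1 q.1.2 (h q.1.2) := by
  apply le_antisymm
  · rw [Submodule.span_le]
    rintro p ⟨w, hw, hD, rfl⟩
    obtain ⟨q0, hq0, hq0l, hQ, hP, hDs⟩ := rs_forward hw
    obtain ⟨q, v, rfl⟩ : ∃ q v, q0 = q ++ [v] := by
      refine ⟨q0.dropLast, q0.getLast (by rintro rfl; simp at hq0l), ?_⟩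
      exact (List.dropLast_append_getLast _).symm
    have hql : q.length = n := by simpa using hq0l
    obtain ⟨hqv, hv1⟩ := (valid_append).mp hq0
    obtain ⟨s, hsl, hsv, hs⟩ := evW_surj n q hql hqv
    subst hs
    have hnd := (Valid.nodup hq0).1
    have hvs : v ∉ evW n s := by
      intro hh
      have := (List.nodup_append.mp hnd).2.2 v hh v (by simp)
      exact this rfl
    have htf := evW_toFinset n s hsl
    have hDc := Dsic_eq hsv hsl
    rw [hDs] at hD ⊢
    have hDI := (DsiSet_snoc_sub hn hql hnd I).mp hD
    have hlow := Valid.low_toFinset hsv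
    have hcells : (toYD s.toFinset hlow).cells = s.toFinset := rfl
    have hcard : (toYD s.toFinset hlow).cells.card = n := by
      rw [hcells, List.toFinset_card_of_nodup (Valid.nodup hsv).1, hsl]
    have hstd : IsStandard (toYD s.toFinset hlow) (tabOf s) := tabOf_standard hsv _ hcells
    let idx : SIdx n I := ⟨(toYD s.toFinset hlow, tabOf s), hcard, hstd, by rw [hDc]; exact hDI⟩
    have hins : insert v s.toFinset = (evW n s ++ [v]).toFinset := by
      rw [List.toFinset_append, htf]; ext; simp [or_comm]
    have hcor : IsCorner idx.1.1 v := by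
      refine ⟨?_, toYD (evW n s ++ [v]).toFinset (Valid.low_toFinset hq0), ?_⟩
      · show v ∉ s.toFinset
        rw [← htf]; simpa using hvs
      · exact hins.symm
    refine (le_iSup (fun q : SIdx n I => IndVSh t n q.1.1 q.1.2 (h q.1.2)) idx) ?_
    unfold IndVSh
    refine (le_iSup₂ (f := fun v (_ : IsCorner idx.1.1 v) => VSh (n + 1) (insert v idx.1.1.cells)
      (Sadd n idx.1.2 v) (addAt (h idx.1.2) t (deltaSV n idx.1.2 v))) v hcor) ?_
    unfold VSh polyMul
    refine ⟨Fw (n + 1) w, ?_, ?_⟩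
    · apply Submodule.subset_span
      refine ⟨Ptab (n + 1) w, ?_, ?_⟩
      · show IsFillingF (insert v s.toFinset) _
        rw [hins]; exact hP
      · show _ = FTS (n + 1) _ (Sadd n (tabOf s) v)
        rw [Sadd_tabOf hsl hsv hvs, Fw, Qt, hQ]
    · show eProd _ (addAt (h (tabOf s)) t (deltaSV n (tabOf s) v)) * _ = _
      rw [hgh, prod_snoc hn hql hnd I hI, hDc, mul_comm]
      unfold deltaSV evac
      rw [evac_tabOf n s hsl hsv]
  · refine iSup_le ?_
    rintro ⟨⟨μ, S⟩, hcard, hstd, hDI⟩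
    unfold IndVSh
    refine iSup₂_le ?_
    rintro v ⟨hvμ, ν, hν⟩
    obtain ⟨s, hsv, hstf, hsl, rfl⟩ := standard_exists_word hstd
    simp only at hcard hstd hDI hvμ hν hstf hsl ⊢
    rw [hcard] at hsl
    have htf := evW_toFinset n s hsl
    have hql := evW_length n s hsl
    have hqv := evW_valid n s hsl hsv
    have hDc := Dsic_eq hsv hsl
    have hvs : v ∉ evW n s := by
      rw [← List.mem_toFinset, htf, hstf]; exact hvμ
    have hqtf : (evW n s ++ [v]).toFinset = ν.cells := by
      rw [List.toFinset_append, htf, hstf, hν]; ext; simp [or_comm]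
    have hq : Valid ∅ (evW n s ++ [v]) := by
      rw [valid_append]
      refine ⟨hqv, ?_⟩
      rw [Finset.union_empty, htf, hstf]
      refine ⟨low_YD μ, hvμ, ?_⟩
      show Low (insert v μ.cells)
      rw [← hν]
      exact low_YD ν
    have hnd := (Valid.nodup hq).1
    have hνc : ν.cells.card = n + 1 := by
      rw [hν, Finset.card_insert_of_notMem hvμ, hcard]
    rw [Sadd_tabOf hsl hsv hvs, ← hν]
    unfold VSh polyMul VS
    rw [Submodule.map_span, Submodule.span_le]
    rintro _ ⟨_, ⟨T, hT, rfl⟩, rfl⟩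
    have hst := FTS_straight (S := evac (n + 1) (tabOf (evW n s ++ [v]))) hνc hT
    have hst2 := Submodule.mem_map_of_mem (f := LinearMap.mulLeft ℚ
      (eProd (n + 1) (addAt (h (tabOf s)) t (deltaSV n (tabOf s) v)))) hst
    refine (show Submodule.map _ _ ≤ _ from ?_) hst2
    rw [Submodule.map_span, Submodule.span_le]
    rintro _ ⟨_, ⟨T', hT', rfl⟩, rfl⟩
    apply Submodule.subset_span
    obtain ⟨w, hw, hP, hQ⟩ := rs_backward hT' hνc hq hqtf
    have hDs : DslSet (n + 1) w = DsiSet (n + 1) (tabOf (evW n s ++ [v])) := by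
      obtain ⟨q0, _, _, hQ0, _, hDs⟩ := rs_forward hw
      rw [hDs, ← hQ0, hQ]
    refine ⟨w, hw, ?_, ?_⟩
    · rw [hDs, DsiSet_snoc_sub hn hql hnd, ← hDc]; exact hDI
    · rw [hDs, prod_snoc hn hql hnd I hI, Fw, Qt, hP, hQ, LinearMap.mulLeft_apply, hgh, hDc, mul_comm]
      unfold deltaSV evac
      rw [evac_tabOf n s hsl hsv]

/-- For `I ⊆ {1,…,n-1}` with `|I| = k - 1`, applying the induction
operators summand-by-summand to the decompositions of `R_{n,I}` and `R^hom_{n,I}` gives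
`R_{n+1, I ∪ {n}} = Ind_{n-k} R_{n,I}` and `R^hom_{n+1, I ∪ {n}} = Ind_n R^hom_{n,I}`. -/
theorem statement_3 (n k : ℕ) (I : Finset ℕ) (hI : I ⊆ Finset.Ioo 0 n)
    (hIcard : I.card = k - 1) (hk : 1 ≤ k) (hkn : k ≤ n) :
    RnI (n + 1) (insert n I) = IndR (n - k) n I ∧
    RnIhom (n + 1) (insert n I) = IndRhom n n I := by
  have hn : 1 ≤ n := hk.trans hkn
  constructor
  · refine main_generic n hn (n - k) I hI
      (fun i => esym (n + 1) (rIdxI (n + 1) (insert n I) i)) (hSI n I) ?_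
    intro S δ
    rw [eProd_addAt _ _ _ _ (by omega), eProd_hSI n (n + 1) (by omega)]
    simp only [rIdxI_insert]
    rw [rIdxI_self n k I hI hIcard hk hkn]
  · refine main_generic n hn n I hI (fun i => esym (n + 1) i) (hInd n I) ?_
    intro S δ
    rw [eProd_addAt _ _ _ _ (by omega), eProd_hInd n (n + 1) (by omega) I hI]

end HigherSpecht
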